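/- arXiv:2408.07182 — 5 statements merged into one kernel-verified Lean document; each statement's English description precedes it below -/
import Mathlib

section
/- Let g : ℝ^d → ℝ ∪ {+∞} be proper and convex, let α > 0, let d ∈ ℝ^d, and let x ∈ ℝ^d be such that ∂g(x) ≠ ∅. If y ∈ ℝ^d is a minimizer of the function z ↦ g(z) + ‖z − (x − α·d)‖²/(2α), then (1/α)·‖y − x‖ ≤ 2‖d‖ + 2·inf{‖v‖ : v ∈ ∂g(x)} (equivalently, ‖y − x‖ ≤ 2α(‖d‖ + ‖v‖) for every v ∈ ∂g(x)). -/
open scoped RealInnerProductSpace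

noncomputable section

/-- Euclidean space ℝ^d. -/
abbrev Euc (d : ℕ) := EuclideanSpace ℝ (Fin d)

/-- Convex subdifferential of an extended-real-valued function:
`∂g(x) = {v | ∀ y, g(y) ≥ g(x) + ⟨v, y − x⟩}`. -/
def Subdiff {d : ℕ} (g : Euc d → EReal) (x : Euc d) : Set (Euc d) :=
  {v | ∀ y : Euc d, g x + ((⟪v, y - x⟫ : ℝ) : EReal) ≤ g y}

/-- A function with values in ℝ ∪ {±∞} is proper if it is somewhere finite
and never takes the value −∞. -/
def ProperFn {d : ℕ} (g : Euc d → EReal) : Prop :=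
  (∃ x, g x ≠ ⊤) ∧ ∀ x, g x ≠ ⊥

/-- Convexity of an extended-real-valued function, via convexity of its epigraph. -/
def ConvexFn {d : ℕ} (g : Euc d → EReal) : Prop :=
  Convex ℝ {p : Euc d × ℝ | g p.1 ≤ (p.2 : EReal)}

/-- if `y` minimizes `z ↦ g(z) + ‖z − (x − α d)‖²/(2α)` and `∂g(x) ≠ ∅`,
then `‖y − x‖ ≤ 2α(‖d‖ + ‖v‖)` for every `v ∈ ∂g(x)`. -/
theorem stmt0 {d : ℕ} (g : Euc d → EReal)
    (hproper : ProperFn g) (hconvex : ConvexFn g)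
    (α : ℝ) (hα : 0 < α) (dvec x : Euc d)
    (hsub : (Subdiff g x).Nonempty)
    (y : Euc d)
    (hy : ∀ z : Euc d,
      g y + ((‖y - (x - α • dvec)‖ ^ 2 / (2 * α) : ℝ) : EReal) ≤
        g z + ((‖z - (x - α • dvec)‖ ^ 2 / (2 * α) : ℝ) : EReal)) :
    ∀ v ∈ Subdiff g x, ‖y - x‖ ≤ 2 * α * (‖dvec‖ + ‖v‖) := by
  intro v hv
  have hgx_top : g x ≠ ⊤ := by
    intro h
    obtain ⟨u, hu⟩ := hproper.1
    have := hv u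
    rw [h, EReal.top_add_coe, top_le_iff] at this
    exact hu this
  have hmin := hy x
  have hsubgrad := hv y
  have hgy_top : g y ≠ ⊤ := by
    intro h
    rw [h, EReal.top_add_coe, top_le_iff] at hmin
    exact EReal.add_ne_top hgx_top (EReal.coe_ne_top _) hmin
  lift g x to ℝ using ⟨hgx_top, hproper.2 x⟩ with a
  lift g y to ℝ using ⟨hgy_top, hproper.2 y⟩ with b
  norm_cast at hmin hsubgrad
  have hsq : ‖y - (x - α • dvec)‖ ^ 2
      = ‖y - x‖ ^ 2 + 2 * α * ⟪y - x, dvec⟫ + ‖x - (x - α • dvec)‖ ^ 2 := by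
    rw [show y - (x - α • dvec) = (y - x) + α • dvec by abel, sub_sub_cancel,
      norm_add_sq_real, real_inner_smul_right]
    ring
  have hdiff : ‖y - x‖ ^ 2 / (2 * α) + ⟪y - x, dvec⟫ ≤ -⟪v, y - x⟫ := by
    rw [hsq] at hmin
    have : (‖y - x‖ ^ 2 + 2 * α * ⟪y - x, dvec⟫ + ‖x - (x - α • dvec)‖ ^ 2) / (2 * α)
        = ‖y - x‖ ^ 2 / (2 * α) + ⟪y - x, dvec⟫ + ‖x - (x - α • dvec)‖ ^ 2 / (2 * α) := by
      field_simp
    linarith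
  have hd := neg_le_of_abs_le (abs_real_inner_le_norm (y - x) dvec)
  have hv' := neg_le_of_abs_le (abs_real_inner_le_norm v (y - x))
  have hquad : ‖y - x‖ ^ 2 ≤ ‖y - x‖ * (‖dvec‖ + ‖v‖) * (2 * α) := by
    rw [← div_le_iff₀ (by positivity)]
    linarith
  rcases (norm_nonneg (y - x)).eq_or_lt with h0 | hpos
  · rw [← h0]
    positivity
  · refine le_of_mul_le_mul_left ?_ hpos
    linarith
end
end

section
/- Let g : ℝ^d → ℝ ∪ {+∞} be proper and convex, with closed domain dom g := {x : g(x) < +∞}, and locally Lipschitz continuous on dom g. Then dom ∂g = dom g, and the function x ↦ d(0, ∂g(x)) := inf{‖v‖ : v ∈ ∂g(x)} is locally bounded on dom g: for every x̄ ∈ dom g there exist ε > 0 and C ≥ 0 such that for every x ∈ dom g with ‖x − x̄‖ ≤ ε one has ∂g(x) ≠ ∅ and inf{‖v‖ : v ∈ ∂g(x)} ≤ C. -/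
open scoped RealInnerProductSpace

noncomputable section

/-- Locally Lipschitz on the domain `{x | g x ≠ ⊤}`. -/
def LocLipOnDom {d : ℕ} (g : Euc d → EReal) : Prop :=
  ∀ x : Euc d, g x ≠ ⊤ → ∃ ε > (0:ℝ), ∃ K : ℝ, ∀ y : Euc d, g y ≠ ⊤ → ∀ z : Euc d, g z ≠ ⊤ →
    ‖y - x‖ ≤ ε → ‖z - x‖ ≤ ε → |(g y).toReal - (g z).toReal| ≤ K * ‖y - z‖

/-- A convex function with a local linear minorant `g x - K ‖y - x‖` has it globally. -/
theorem ConvexFn.minorant_of_local {d : ℕ} {g : Euc d → EReal} (hbot : ∀ y, g y ≠ ⊥)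
    (hconvex : ConvexFn g) {x : Euc d} (hx : g x ≠ ⊤) {K ε : ℝ} (hε : 0 < ε)
    (h : ∀ y, g y ≠ ⊤ → ‖y - x‖ ≤ ε → (g x).toReal - K * ‖y - x‖ ≤ (g y).toReal)
    (y : Euc d) (hy : g y ≠ ⊤) : (g x).toReal - K * ‖y - x‖ ≤ (g y).toReal := by
  have hn : 0 < ‖y - x‖ + 1 := by positivity
  obtain ⟨s, hs0, hs1, hs⟩ : ∃ s : ℝ, 0 < s ∧ s ≤ 1 ∧ s * ‖y - x‖ ≤ ε := by
    refine ⟨min 1 (ε / (‖y - x‖ + 1)), by positivity, min_le_left _ _, ?_⟩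
    calc min 1 (ε / (‖y - x‖ + 1)) * ‖y - x‖
        ≤ ε / (‖y - x‖ + 1) * (‖y - x‖ + 1) := by
          gcongr
          · exact min_le_right _ _
          · linarith
      _ = ε := div_mul_cancel₀ _ hn.ne'
  have hc : g ((1 - s) • x + s • y) ≤
      (((1 - s) * (g x).toReal + s * (g y).toReal : ℝ) : EReal) :=
    hconvex (x := (x, (g x).toReal)) (EReal.coe_toReal hx (hbot x)).ge
      (y := (y, (g y).toReal)) (EReal.coe_toReal hy (hbot y)).ge
      (sub_nonneg.2 hs1) hs0.le (by ring)
  have hz : g ((1 - s) • x + s • y) ≠ ⊤ := ne_top_of_le_ne_top (EReal.coe_ne_top _) hc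
  have hnorm : ‖(1 - s) • x + s • y - x‖ = s * ‖y - x‖ := by
    rw [show (1 - s) • x + s • y - x = s • (y - x) by module, norm_smul,
      Real.norm_of_nonneg hs0.le]
  have hl := h _ hz (hnorm.trans_le hs)
  rw [← EReal.coe_toReal hz (hbot _), EReal.coe_le_coe_iff] at hc
  rw [hnorm] at hl
  refine le_of_mul_le_mul_left ?_ hs0
  linarith

/-- A convex function minorized by `g x - K ‖y - x‖` has a subgradient at `x` of norm
at most `K`. -/
theorem ConvexFn.exists_subgradient_norm_le {d : ℕ} {g : Euc d → EReal} (hbot : ∀ y, g y ≠ ⊥)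
    (hconvex : ConvexFn g) {x : Euc d} (hx : g x ≠ ⊤) {K : ℝ} (hK : 0 ≤ K)
    (h : ∀ y, g y ≠ ⊤ → (g x).toReal - K * ‖y - x‖ ≤ (g y).toReal) :
    ∃ v ∈ Subdiff g x, ‖v‖ ≤ K := by
  set r := (g x).toReal
  have hgx : g x = (r : EReal) := (EReal.coe_toReal hx (hbot x)).symm
  have hopen : IsOpen {p : Euc d × ℝ | p.2 + K * ‖p.1 - x‖ < r} :=
    isOpen_lt (by fun_prop) continuous_const
  have hconv : Convex ℝ {p : Euc d × ℝ | p.2 + K * ‖p.1 - x‖ < r} := by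
    have h1 : ConvexOn ℝ Set.univ fun p : Euc d × ℝ => p.2 + K * ‖p.1 - x‖ := by
      refine ⟨convex_univ, fun p _ q _ a b ha hb hab => ?_⟩
      have hsplit : (a • p + b • q).1 - x = a • (p.1 - x) + b • (q.1 - x) := by
        have : x = (a + b) • x := by rw [hab, one_smul]
        simp only [Prod.fst_add, Prod.smul_fst]
        nth_rewrite 1 [this]
        module
      have hle : ‖(a • p + b • q).1 - x‖ ≤ a * ‖p.1 - x‖ + b * ‖q.1 - x‖ := by
        rw [hsplit]
        refine (norm_add_le _ _).trans_eq ?_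
        rw [norm_smul, norm_smul, Real.norm_of_nonneg ha, Real.norm_of_nonneg hb]
      have := mul_le_mul_of_nonneg_left hle hK
      simp only [Prod.snd_add, Prod.smul_snd, smul_eq_mul] at this ⊢
      linarith
    simpa using h1.convex_lt r
  have hdisj : Disjoint {p : Euc d × ℝ | p.2 + K * ‖p.1 - x‖ < r}
      {p : Euc d × ℝ | g p.1 ≤ (p.2 : EReal)} := by
    refine Set.disjoint_left.2 fun p hp hq => ?_
    simp only [Set.mem_ofPred_eq] at hp hq
    have ht : g p.1 ≠ ⊤ := ne_top_of_le_ne_top (EReal.coe_ne_top _) hq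
    have := h _ ht
    rw [← EReal.coe_toReal ht (hbot _), EReal.coe_le_coe_iff] at hq
    linarith
  obtain ⟨f, u, hlow, hepi⟩ := geometric_hahn_banach_open hconv hopen hconvex hdisj
  set c := f (0, 1) with hc
  have hf : ∀ y t, f (y, t) = f (y, 0) + t * c := fun y t => by
    rw [hc, ← smul_eq_mul, ← map_smul, ← map_add]
    simp
  have hux : u ≤ f (x, 0) + r * c := hf x r ▸ hepi (x, r) hgx.le
  have hcpos : 0 < c := by
    have := hlow (x, r - 1) (by simp)
    rw [hf] at this
    linarith
  have hlow' : ∀ y, f (y, 0) + (r - K * ‖y - x‖) * c ≤ u := fun y => by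
    refine le_of_forall_pos_lt_add fun δ hδ => ?_
    have := hlow (y, r - K * ‖y - x‖ - δ / c) (by
      have := div_pos hδ hcpos
      rw [Set.mem_ofPred_eq]
      linarith)
    rw [hf, sub_mul, div_mul_cancel₀ _ hcpos.ne'] at this
    linarith
  have hu : f (x, 0) + r * c ≤ u := by simpa using hlow' x
  set φ : Euc d →L[ℝ] ℝ := -c⁻¹ • f.comp (ContinuousLinearMap.inl ℝ (Euc d) ℝ) with hφ
  have hφc : ∀ y, φ (y - x) * c = f (x, 0) - f (y, 0) := fun y => by
    have : f (y - x, 0) = f (y, 0) - f (x, 0) := by rw [← map_sub]; simp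
    simp [hφ, this]
    field_simp
    ring
  refine ⟨(InnerProductSpace.toDual ℝ (Euc d)).symm φ, fun y => ?_, ?_⟩
  · rw [InnerProductSpace.toDual_symm_apply]
    by_cases hy : g y = ⊤
    · simp [hy]
    have h1 := hepi (y, (g y).toReal) (EReal.coe_toReal hy (hbot y)).ge
    rw [hf] at h1
    rw [hgx, ← EReal.coe_toReal hy (hbot y), ← EReal.coe_add, EReal.coe_le_coe_iff]
    refine le_of_mul_le_mul_right ?_ hcpos
    linarith [hφc y]
  · rw [LinearIsometryEquiv.norm_map]
    have hle : ∀ w, -φ w ≤ K * ‖w‖ := fun w => by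
      have h1 := hlow' (x + w)
      have h2 := hφc (x + w)
      rw [add_sub_cancel_left] at h1 h2
      refine le_of_mul_le_mul_right ?_ hcpos
      linarith
    refine φ.opNorm_le_bound hK fun w => abs_le'.2 ⟨?_, hle w⟩
    simpa using hle (-w)

/-- for a proper convex `g`, locally Lipschitz on its closed domain,
one has `dom ∂g = dom g` and `x ↦ d(0, ∂g(x))` is locally bounded on `dom g`. -/
theorem stmt1 {d : ℕ} (g : Euc d → EReal)
    (hproper : ProperFn g) (hconvex : ConvexFn g)
    (hclosed : IsClosed {x : Euc d | g x ≠ ⊤})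
    (hlip : LocLipOnDom g) :
    ({x : Euc d | (Subdiff g x).Nonempty} = {x : Euc d | g x ≠ ⊤}) ∧
    ∀ x₀ : Euc d, g x₀ ≠ ⊤ → ∃ ε > (0:ℝ), ∃ C : ℝ, 0 ≤ C ∧
      ∀ x : Euc d, g x ≠ ⊤ → ‖x - x₀‖ ≤ ε →
        (Subdiff g x).Nonempty ∧
        EMetric.infEdist (0 : Euc d) (Subdiff g x) ≤ ENNReal.ofReal C := by
  have key : ∀ x₀ : Euc d, g x₀ ≠ ⊤ → ∃ ε > (0 : ℝ), ∃ C : ℝ, 0 ≤ C ∧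
      ∀ x : Euc d, g x ≠ ⊤ → ‖x - x₀‖ ≤ ε → ∃ v ∈ Subdiff g x, ‖v‖ ≤ C := by
    intro x₀ hx₀
    obtain ⟨ε, hε, K, hK⟩ := hlip x₀ hx₀
    refine ⟨ε / 2, half_pos hε, max K 0, le_max_right _ _, fun x hx hxx => ?_⟩
    refine hconvex.exists_subgradient_norm_le hproper.2 hx (le_max_right _ _)
      (hconvex.minorant_of_local hproper.2 hx (half_pos hε) fun y hy hyx => ?_)
    have hyx₀ : ‖y - x₀‖ ≤ ε := by
      linarith [norm_sub_le_norm_sub_add_norm_sub y x x₀]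
    have h1 := (abs_le.1 (hK y hy x hx hyx₀ (by linarith))).1
    have h2 := mul_le_mul_of_nonneg_right (le_max_left K 0) (norm_nonneg (y - x))
    linarith
  refine ⟨Set.Subset.antisymm ?_ ?_, fun x₀ hx₀ => ?_⟩
  · rintro x ⟨v, hv⟩ hx
    obtain ⟨y, hy⟩ := hproper.1
    refine hy (top_le_iff.1 ?_)
    simpa [hx] using hv y
  · intro x hx
    obtain ⟨ε, hε, C, -, h⟩ := key x hx
    obtain ⟨v, hv, -⟩ := h x hx (by simpa using hε.le)
    exact ⟨v, hv⟩
  · obtain ⟨ε, hε, C, hC, h⟩ := key x₀ hx₀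
    refine ⟨ε, hε, C, hC, fun x hx hxx => ?_⟩
    obtain ⟨v, hv, hvC⟩ := h x hx hxx
    refine ⟨⟨v, hv⟩, (Metric.infEDist_le_edist_of_mem hv).trans ?_⟩
    rw [edist_dist, dist_zero_left]
    exact ENNReal.ofReal_le_ofReal hvC
end
end

section
/- Let N ≥ 1, let D₁, …, D_N : ℝ^d → Set(ℝ^d) be set-valued maps, let g : ℝ^d → ℝ ∪ {+∞} be proper, lower semicontinuous and convex, let X ⊂ ℝ^d be bounded, let L > 0 satisfy ‖v‖ ≤ L for every v ∈ D_i(y), every i, and every y ∈ B(X,1), and let L_g ≥ 0 satisfy inf{‖w‖ : w ∈ ∂g(y)} ≤ L_g for every y ∈ B(X,1) ∩ dom g. Let K ∈ ℕ, x₀, …, x_K ∈ X ∩ dom ∂g, and α₀, …, α_K ∈ (0, 1/(2NL + 2L_g)]; suppose for each k ∈ {0,…,K} there are a permutation σ^k of {1,…,N} and points x_{k,0}, …, x_{k,N} with x_{k,0} = x_k, x_{k,i} ∈ x_{k,i−1} − α_k · D_{σ^k(i)}(x_{k,i−1}) for i = 1,…,N, and x_{k+1} = prox_{α_k g}(x_{k,N}).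 Then ‖x_{k+1} − x_k‖ ≤ 2(NL + L_g)·α_k for all k ∈ {0,…,K}, and x_{K+1} ∈ B(X,1). -/
open scoped RealInnerProductSpace

noncomputable section

/-- `B(X,r) = {y : ∃ s ∈ X, ‖y − s‖ ≤ r}`. -/
def BallSet {d : ℕ} (X : Set (Euc d)) (r : ℝ) : Set (Euc d) :=
  {y : Euc d | ∃ s ∈ X, ‖y - s‖ ≤ r}

/-- Lower semicontinuity via closedness of the epigraph. -/
def LscFn {d : ℕ} (g : Euc d → EReal) : Prop :=
  IsClosed {p : Euc d × ℝ | g p.1 ≤ (p.2 : EReal)}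

theorem mem_ballSet_of_norm_sub_le {d : ℕ} {X : Set (Euc d)} {s y : Euc d} {r : ℝ}
    (hs : s ∈ X) (h : ‖y - s‖ ≤ r) : y ∈ BallSet X r :=
  ⟨s, hs, h⟩

/-- A point with a subgradient lies in the domain of a proper function. -/
theorem ne_top_of_subdiff_nonempty {d : ℕ} {g : Euc d → EReal} (hg : ProperFn g) {x : Euc d}
    (hx : (Subdiff g x).Nonempty) : g x ≠ ⊤ := by
  obtain ⟨v, hv⟩ := hx
  obtain ⟨y, hy⟩ := hg.1
  intro h
  have := hv y
  rw [h, EReal.top_add_coe, top_le_iff] at this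
  exact hy this

/-- A proximal step moves a point `x` with subgradient `v` by at most `2 (a ‖v‖ + ‖z - x‖)`,
where `z` is the point at which the proximal map is evaluated. -/
theorem norm_prox_sub_le {d : ℕ} {g : Euc d → EReal} (hg : ProperFn g) {x p z v : Euc d}
    {a : ℝ} (ha : 0 < a) (hv : v ∈ Subdiff g x)
    (hp : g p + ((‖p - z‖ ^ 2 / (2 * a) : ℝ) : EReal) ≤
      g x + ((‖x - z‖ ^ 2 / (2 * a) : ℝ) : EReal)) :
    ‖p - x‖ ≤ 2 * (a * ‖v‖ + ‖z - x‖) := by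
  have hx : g x ≠ ⊤ := ne_top_of_subdiff_nonempty hg ⟨v, hv⟩
  have hpt : g p ≠ ⊤ := by
    intro h
    rw [h, EReal.top_add_coe, top_le_iff] at hp
    exact EReal.add_ne_top hx (EReal.coe_ne_top _) hp
  have hvp := hv p
  lift g x to ℝ using ⟨hx, hg.2 x⟩ with gx
  lift g p to ℝ using ⟨hpt, hg.2 p⟩ with gp
  norm_cast at hp hvp
  have hquad : ‖p - z‖ ^ 2 / (2 * a) ≤ ‖x - z‖ ^ 2 / (2 * a) + ‖v‖ * ‖p - x‖ := by
    have := neg_le_of_abs_le (abs_real_inner_le_norm v (p - x))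
    linarith
  have hsq : ‖p - z‖ ^ 2 ≤ ‖x - z‖ ^ 2 + 2 * a * (‖v‖ * ‖p - x‖) := by
    have h2a : 0 < 2 * a := by positivity
    rw [div_add' _ _ _ h2a.ne', div_le_div_iff_of_pos_right h2a] at hquad
    linarith
  have hexp : ‖p - z‖ ^ 2 = ‖p - x‖ ^ 2 - 2 * ⟪p - x, z - x⟫ + ‖z - x‖ ^ 2 := by
    rw [← norm_sub_sq_real, sub_sub_sub_cancel_right]
  have hcs := real_inner_le_norm (p - x) (z - x)
  rw [norm_sub_rev x z] at hsq
  by_contra! hlt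
  have hpos : 0 < ‖p - x‖ := lt_of_le_of_lt (by positivity) hlt
  nlinarith [mul_lt_mul_of_pos_right hlt hpos]

/-- The partial iterates of an incremental sweep stay close to its starting point. -/
theorem norm_sweep_sub_le {d N : ℕ} {D : Fin N → Euc d → Set (Euc d)} {X : Set (Euc d)} {L : ℝ}
    (hL : 0 ≤ L) (hD : ∀ (i : Fin N) (y : Euc d), y ∈ BallSet X 1 → ∀ v ∈ D i y, ‖v‖ ≤ L)
    {a : ℝ} (ha : 0 ≤ a) (haL : N * L * a ≤ 1) (τ : Fin N → Fin N) (z : ℕ → Euc d)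
    (hz : z 0 ∈ X)
    (hstep : ∀ i : Fin N, ∃ v ∈ D (τ i) (z i.1), z (i.1 + 1) = z i.1 - a • v)
    (n : ℕ) (hn : n ≤ N) : ‖z n - z 0‖ ≤ n * L * a := by
  induction n with
  | zero => simp
  | succ m ih =>
    have hm := ih (by omega)
    obtain ⟨v, hv, hzv⟩ := hstep ⟨m, hn⟩
    have hmN : (m : ℝ) * L * a ≤ N * L * a := by
      have : (m : ℝ) ≤ N := by exact_mod_cast (by omega : m ≤ N)
      gcongr
    have hvL := hD _ _ (mem_ballSet_of_norm_sub_le hz ((hm.trans hmN).trans haL)) v hv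
    calc ‖z (m + 1) - z 0‖ = ‖(z m - z 0) - a • v‖ := by rw [hzv, sub_right_comm]
      _ ≤ ‖z m - z 0‖ + ‖a • v‖ := norm_sub_le _ _
      _ ≤ m * L * a + a * L := by
        rw [norm_smul, Real.norm_of_nonneg ha]
        gcongr
      _ = (m + 1 : ℕ) * L * a := by push_cast; ring

/-- one proximal random reshuffling step moves by at most
`2(NL + L_g)α_k`, and `x_{K+1} ∈ B(X,1)`. -/
theorem stmt5 {d : ℕ} (N : ℕ) (hN : 1 ≤ N) (D : Fin N → Euc d → Set (Euc d))
    (g : Euc d → EReal) (hgp : ProperFn g) (hglsc : LscFn g) (hgc : ConvexFn g)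
    (X : Set (Euc d)) (hX : Bornology.IsBounded X)
    (L : ℝ) (hL : 0 < L)
    (hLbound : ∀ (i : Fin N) (y : Euc d), y ∈ BallSet X 1 → ∀ v ∈ D i y, ‖v‖ ≤ L)
    (Lg : ℝ) (hLg : 0 ≤ Lg)
    (hLgbound : ∀ y : Euc d, y ∈ BallSet X 1 → g y ≠ ⊤ →
      EMetric.infEdist (0 : Euc d) (Subdiff g y) ≤ ENNReal.ofReal Lg)
    (K : ℕ) (x : ℕ → Euc d)
    (hx : ∀ k ≤ K, x k ∈ X ∧ (Subdiff g (x k)).Nonempty)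
    (α : ℕ → ℝ) (hα : ∀ k ≤ K, 0 < α k ∧ α k ≤ 1 / (2 * N * L + 2 * Lg))
    (σ : ℕ → Equiv.Perm (Fin N)) (z : ℕ → ℕ → Euc d)
    (hz0 : ∀ k ≤ K, z k 0 = x k)
    (hstep : ∀ k ≤ K, ∀ i : Fin N,
      ∃ v ∈ D (σ k i) (z k i.1), z k (i.1 + 1) = z k i.1 - α k • v)
    (hprox : ∀ k ≤ K, ∀ w : Euc d,
      g (x (k+1)) + ((‖x (k+1) - z k N‖ ^ 2 / (2 * α k) : ℝ) : EReal) ≤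
        g w + ((‖w - z k N‖ ^ 2 / (2 * α k) : ℝ) : EReal)) :
    (∀ k ≤ K, ‖x (k+1) - x k‖ ≤ 2 * (N * L + Lg) * α k) ∧
    x (K+1) ∈ BallSet X 1 := by
  have hNpos : (0 : ℝ) < N := by exact_mod_cast hN
  have hNL : 0 < N * L := mul_pos hNpos hL
  have hαle : ∀ k ≤ K, 2 * (N * L + Lg) * α k ≤ 1 := by
    intro k hk
    have h := (hα k hk).2
    rw [le_div_iff₀ (by linarith)] at h
    linarith
  have hmove : ∀ k ≤ K, ‖x (k + 1) - x k‖ ≤ 2 * (N * L + Lg) * α k := by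
    intro k hk
    obtain ⟨hxX, hsub⟩ := hx k hk
    have hapos := (hα k hk).1
    have hsweep : ‖z k N - x k‖ ≤ N * L * α k := by
      rw [← hz0 k hk]
      refine norm_sweep_sub_le hL.le hLbound hapos.le ?_ (σ k) (z k) ?_ (hstep k hk) N le_rfl
      · nlinarith [hαle k hk, mul_nonneg hLg hapos.le, mul_pos hNL hapos]
      · rwa [hz0 k hk]
    have hdist := hLgbound (x k) (mem_ballSet_of_norm_sub_le hxX (by simp))
      (ne_top_of_subdiff_nonempty hgp hsub)
    refine le_of_forall_pos_le_add fun ε hε => ?_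
    have hδ : 0 < ε / (2 * α k) := by positivity
    have hlt : ENNReal.ofReal Lg < ENNReal.ofReal (Lg + ε / (2 * α k)) :=
      (ENNReal.ofReal_lt_ofReal_iff (by positivity)).2 (by linarith)
    obtain ⟨v, hv, hvlt⟩ := Metric.infEDist_lt_iff.1 (hdist.trans_lt hlt)
    rw [edist_dist, ENNReal.ofReal_lt_ofReal_iff (by positivity), dist_zero_left] at hvlt
    calc ‖x (k + 1) - x k‖ ≤ 2 * (α k * ‖v‖ + ‖z k N - x k‖) :=
          norm_prox_sub_le hgp hapos hv (hprox k hk (x k))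
      _ ≤ 2 * (α k * (Lg + ε / (2 * α k)) + N * L * α k) := by gcongr
      _ = 2 * (N * L + Lg) * α k + ε := by field_simp; ring
  exact ⟨hmove, mem_ballSet_of_norm_sub_le (hx K le_rfl).1
    ((hmove K le_rfl).trans (hαle K le_rfl))⟩
end
end

section
/- Let the standing assumptions hold. Then for every bounded set X₀ ⊆ dom Φ and every T > 0 there exist ᾱ > 0 and r > 0 such that for every proximal-random-reshuffling sequence (x_k) initialized at some x₀ ∈ X₀ with step sizes α_k ∈ (0, ᾱ] for all k, and for every k ≥ 1 with α₀ + ⋯ + α_{k−1} ≤ T, one has x₀, x₁, …, x_k ∈ B(0,r) (the closed ball of radius r centered at the origin). -/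
open scoped RealInnerProductSpace
open MeasureTheory

noncomputable section

/-- A set-valued map is locally bounded. -/
def LocBounded {d : ℕ} (F : Euc d → Set (Euc d)) : Prop :=
  ∀ x : Euc d, ∃ ε > (0:ℝ), Bornology.IsBounded (⋃ y ∈ Metric.ball x ε, F y)

/-- `D` is a conservative field for the locally Lipschitz function `f : ℝ^d → ℝ`. -/
def IsConservativeFieldR {d : ℕ} (D : Euc d → Set (Euc d)) (f : Euc d → ℝ) : Prop :=
  IsClosed {p : Euc d × Euc d | p.2 ∈ D p.1} ∧
  ∀ x u : ℝ → Euc d, IntervalIntegrable u volume 0 1 →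
    (∀ t ∈ Set.Icc (0:ℝ) 1, x t = x 0 + ∫ s in (0:ℝ)..t, u s) →
    (∀ t ∈ Set.Icc (0:ℝ) 1, (D (x t)).Nonempty) →
    ∀ᵐ t ∂volume, t ∈ Set.Ioo (0:ℝ) 1 →
      ∀ v ∈ D (x t), HasDerivAt (fun s => f (x s)) (⟪v, u t⟫ : ℝ) t

/-- The objective `Φ = f₁ + ⋯ + f_N + g`. -/
def Phi {d : ℕ} (N : ℕ) (f : Fin N → Euc d → ℝ) (g : Euc d → EReal) (x : Euc d) : EReal :=
  ((∑ i, f i x : ℝ) : EReal) + g x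

/-- The field `D_Φ = D₁ + ⋯ + D_N + ∂g` (pointwise Minkowski sum). -/
def DPhi {d : ℕ} (N : ℕ) (D : Fin N → Euc d → Set (Euc d)) (g : Euc d → EReal)
    (x : Euc d) : Set (Euc d) :=
  {w : Euc d | ∃ v : Fin N → Euc d, (∀ i, v i ∈ D i x) ∧
    ∃ s ∈ Subdiff g x, w = (∑ i, v i) + s}

/-- `(α, x)` is a proximal random reshuffling sequence: at each outer iteration `k`
there are a permutation `σ` and inner iterates `z` performing one subgradient step
for each `D_{σ(i)}` followed by a proximal step for `g`
(`x (k+1)` minimizes `w ↦ g w + ‖w − z_N‖²/(2 α_k)`). -/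
def IsPRR {d : ℕ} (N : ℕ) (D : Fin N → Euc d → Set (Euc d)) (g : Euc d → EReal)
    (α : ℕ → ℝ) (x : ℕ → Euc d) : Prop :=
  ∀ k : ℕ, ∃ (σ : Equiv.Perm (Fin N)) (z : ℕ → Euc d),
    z 0 = x k ∧
    (∀ i : Fin N, ∃ v ∈ D (σ i) (z i.1), z (i.1 + 1) = z i.1 - α k • v) ∧
    (∀ w : Euc d,
      g (x (k+1)) + ((‖x (k+1) - z N‖ ^ 2 / (2 * α k) : ℝ) : EReal) ≤
        g w + ((‖w - z N‖ ^ 2 / (2 * α k) : ℝ) : EReal))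

/-- Standing assumptions of the paper: each `f_i` is locally Lipschitz, each `D_i`
is a locally bounded conservative field for `f_i` with nonempty convex values,
`g` is proper, convex, with closed domain and locally Lipschitz on its domain,
and `Φ = f₁ + ⋯ + f_N + g` is bounded below. -/
def StandingAssumptions {d : ℕ} (N : ℕ) (f : Fin N → Euc d → ℝ)
    (D : Fin N → Euc d → Set (Euc d)) (g : Euc d → EReal) : Prop :=
  (∀ i, LocallyLipschitz (f i)) ∧
  (∀ i, IsConservativeFieldR (D i) (f i)) ∧
  (∀ i, LocBounded (D i)) ∧
  (∀ i x, (D i x).Nonempty ∧ Convex ℝ (D i x)) ∧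
  ProperFn g ∧ ConvexFn g ∧ IsClosed {x : Euc d | g x ≠ ⊤} ∧ LocLipOnDom g ∧
  ∃ c : ℝ, ∀ x : Euc d, (c : EReal) ≤ Phi N f g x

section Curves

open Filter Topology Set
open scoped NNReal

variable {E : Type*} [NormedAddCommGroup E] [InnerProductSpace ℝ E]

/-- A Lipschitz curve in a finite-dimensional space is the integral of its derivative. -/
lemma LipschitzWith.eq_add_integral_deriv [FiniteDimensional ℝ E] {K : ℝ≥0} {y : ℝ → E}
    (hy : LipschitzWith K y) :
    IntervalIntegrable (deriv y) volume 0 1 ∧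
      ∀ t ∈ Icc (0:ℝ) 1, y t = y 0 + ∫ s in (0:ℝ)..t, deriv y s := by
  have hint : ∀ t : ℝ, IntervalIntegrable (deriv y) volume 0 t := fun t =>
    (intervalIntegrable_const (c := (K : ℝ))).mono_fun
      (aestronglyMeasurable_deriv y _)
      (Eventually.of_forall fun s => by
        simpa using norm_deriv_le_of_lipschitz hy)
  refine ⟨hint 1, fun t _ => ?_⟩
  have key : (∫ s in (0:ℝ)..t, deriv y s) = y t - y 0 := by
    refine ext_inner_left ℝ fun v => ?_
    have hlip : LipschitzWith (‖innerSL ℝ v‖₊ * K) fun s => (⟪v, y s⟫ : ℝ) :=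
      (innerSL ℝ v).lipschitz.comp hy
    have hFTC := ((hlip.lipschitzOnWith (s := uIcc 0 t)).absolutelyContinuousOnInterval).integral_deriv_eq_sub
    rw [inner_sub_right, ← hFTC]
    have h1 := (innerSL ℝ v).intervalIntegral_comp_comm (hint t)
    simp only [innerSL_apply_apply] at h1
    rw [← h1]
    refine intervalIntegral.integral_congr_ae ?_
    filter_upwards [hy.ae_differentiableAt] with s hs _
    exact (((innerSL ℝ v).hasFDerivAt.comp_hasDerivAt s hs.hasDerivAt).deriv).symm
  rw [key]; abel

lemma AbsolutelyContinuousOnInterval.le_of_ae_hasDerivAt_nonpos {φ : ℝ → ℝ} {a b : ℝ} (hab : a ≤ b)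
    (hφ : AbsolutelyContinuousOnInterval φ a b)
    (h : ∀ᵐ t ∂volume, t ∈ Ioo a b → ∃ c ≤ 0, HasDerivAt φ c t) : φ b ≤ φ a := by
  have hFTC := hφ.integral_deriv_eq_sub
  have : ∫ t in a..b, deriv φ t ≤ 0 := by
    rw [intervalIntegral.integral_of_le hab, integral_Ioc_eq_integral_Ioo]
    refine setIntegral_nonpos_ae measurableSet_Ioo ?_
    filter_upwards [h] with t ht htI
    obtain ⟨c, hc, hd⟩ := ht htI
    rwa [hd.deriv]
  linarith

lemma AbsolutelyContinuousOnInterval.finset_sum {ι : Type*} (s : Finset ι) {f : ι → ℝ → ℝ}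
    {a b : ℝ} (h : ∀ i ∈ s, AbsolutelyContinuousOnInterval (f i) a b) :
    AbsolutelyContinuousOnInterval (∑ i ∈ s, f i) a b :=
  Finset.sum_induction f (AbsolutelyContinuousOnInterval · a b) (fun _ _ h₁ h₂ => h₁.add h₂)
    ((LipschitzWith.const (0 : ℝ)).lipschitzOnWith.absolutelyContinuousOnInterval) h

lemma LocallyLipschitz.absolutelyContinuousOnInterval {φ : ℝ → ℝ} (hφ : LocallyLipschitz φ)
    (a b : ℝ) : AbsolutelyContinuousOnInterval φ a b := by
  obtain ⟨K, hK⟩ := (hφ.locallyLipschitzOn (s := uIcc a b)).exists_lipschitzOnWith_of_compact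
    isCompact_uIcc
  exact hK.absolutelyContinuousOnInterval

/-- Along a curve with `‖y'‖² ≤ -τ φ'`, the displacement is controlled by the decrease of `φ`. -/
lemma sq_norm_sub_le_of_ae_sq_norm_deriv_le {K : ℝ≥0} {y : ℝ → E} (hy : LipschitzWith K y)
    {φ : ℝ → ℝ} (hφ : AbsolutelyContinuousOnInterval φ 0 1) {τ : ℝ}
    (h : ∀ᵐ t ∂volume, t ∈ Ioo (0:ℝ) 1 →
      ∃ (p : E) (c : ℝ), HasDerivAt y p t ∧ HasDerivAt φ c t ∧ ‖p‖ ^ 2 ≤ -(τ * c)) :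
    ‖y 1 - y 0‖ ^ 2 ≤ τ * (φ 0 - φ 1) := by
  set q := y 1 - y 0 with hq
  have hlip : LipschitzWith (‖innerSL ℝ q‖₊ * K) fun s => (⟪q, y s⟫ : ℝ) :=
    (innerSL ℝ q).lipschitz.comp hy
  have hlin : LipschitzWith ‖ContinuousLinearMap.toSpanSingleton ℝ (‖q‖ ^ 2 / 2)‖₊
      fun s : ℝ => s * (‖q‖ ^ 2 / 2) :=
    (ContinuousLinearMap.toSpanSingleton ℝ (‖q‖ ^ 2 / 2)).lipschitz
  have hac := ((hlip.lipschitzOnWith (s := uIcc 0 1)).absolutelyContinuousOnInterval.add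
    (hφ.const_mul (τ / 2))).sub
      (hlin.lipschitzOnWith (s := uIcc 0 1)).absolutelyContinuousOnInterval
  have := hac.le_of_ae_hasDerivAt_nonpos zero_le_one (by
    filter_upwards [h] with t ht htI
    obtain ⟨p, c, hp, hc, hpc⟩ := ht htI
    refine ⟨⟪q, p⟫ + τ / 2 * c - ‖q‖ ^ 2 / 2, ?_, ?_⟩
    · have h1 := real_inner_le_norm q p
      nlinarith [sq_nonneg (‖q‖ - ‖p‖)]
    · have h1 := (innerSL ℝ q).hasFDerivAt.comp_hasDerivAt t hp
      have h2 := ((h1.add (hc.const_mul (τ / 2))).sub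
        ((hasDerivAt_id t).mul_const (‖q‖ ^ 2 / 2)))
      simpa using! h2)
  simp only [Pi.add_apply, Pi.sub_apply] at this
  have h3 : (⟪q, y 1⟫ : ℝ) - ⟪q, y 0⟫ = ‖q‖ ^ 2 := by
    rw [← inner_sub_right, ← hq, real_inner_self_eq_norm_sq]
  linarith

end Curves

section Fields

open Filter Topology Set
open scoped NNReal

variable {E : Type*} [NormedAddCommGroup E] [InnerProductSpace ℝ E]

/-- If `⟪·, p⟫` is constant on the value at `x₀` of a locally bounded map with closed graph, then it
is nearly constant on the nearby values. -/
lemma eventually_abs_inner_sub_lt [ProperSpace E] {F : E → Set E}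
    (hF : IsClosed {q : E × E | q.2 ∈ F q.1}) {x₀ p : E} {c C : ℝ}
    (hb : ∀ᶠ y in 𝓝 x₀, ∀ v ∈ F y, ‖v‖ ≤ C) (hc : ∀ v ∈ F x₀, (⟪v, p⟫ : ℝ) = c)
    {ε : ℝ} (hε : 0 < ε) : ∀ᶠ y in 𝓝 x₀, ∀ v ∈ F y, |(⟪v, p⟫ : ℝ) - c| < ε := by
  by_contra hcon
  have hfr : ∃ᶠ y in 𝓝 x₀, ∃ v ∈ F y, ε ≤ |(⟪v, p⟫ : ℝ) - c| := by
    simpa only [not_eventually, not_forall, not_lt, exists_prop] using hcon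
  have : NeBot (𝓝 x₀ ⊓ 𝓟 {y | ∃ v ∈ F y, ε ≤ |(⟪v, p⟫ : ℝ) - c|}) :=
    frequently_mem_iff_neBot.1 hfr
  obtain ⟨U, hU⟩ := Ultrafilter.exists_le (𝓝 x₀ ⊓ 𝓟 {y | ∃ v ∈ F y, ε ≤ |(⟪v, p⟫ : ℝ) - c|})
  have hbad : ∀ᶠ y in (U : Filter E), ∃ v ∈ F y, ε ≤ |(⟪v, p⟫ : ℝ) - c| :=
    le_principal_iff.1 (hU.trans inf_le_right)
  have hnhds : (U : Filter E) ≤ 𝓝 x₀ := hU.trans inf_le_left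
  obtain ⟨v, hv⟩ := hbad.choice
  have hball : ((U.map v : Ultrafilter E) : Filter E) ≤ 𝓟 (Metric.closedBall 0 C) := by
    rw [le_principal_iff]
    change ∀ᶠ y in (U : Filter E), v y ∈ Metric.closedBall 0 C
    filter_upwards [hv, hnhds hb] with y hy hyC
    simpa using hyC _ hy.1
  obtain ⟨v₀, -, hv₀⟩ := (isCompact_closedBall (0 : E) C).ultrafilter_le_nhds _ hball
  have hv₀' : Tendsto v U (𝓝 v₀) := hv₀
  have hmem : v₀ ∈ F x₀ :=
    hF.mem_of_tendsto ((tendsto_id.mono_left hnhds).prodMk_nhds hv₀') (hv.mono fun y hy => hy.1)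
  have hlim : Tendsto (fun y => |(⟪v y, p⟫ : ℝ) - c|) U (𝓝 |(⟪v₀, p⟫ : ℝ) - c|) :=
    ((hv₀'.inner tendsto_const_nhds).sub_const c).abs
  have := ge_of_tendsto hlim (hv.mono fun y hy => hy.2)
  rw [hc _ hmem] at this
  simp at this
  linarith

/-- Subgradients of norm at most `C` of a real function `h` on `S`. -/
def BoundedSubgrad (S : Set E) (h : E → ℝ) (C : ℝ) (x : E) : Set E :=
  {s | x ∈ S ∧ ‖s‖ ≤ C ∧ ∀ y ∈ S, h x + ⟪s, y - x⟫ ≤ h y}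

lemma isClosed_graph_boundedSubgrad {S : Set E} (hS : IsClosed S) {h : E → ℝ}
    (hh : ContinuousOn h S) (C : ℝ) :
    IsClosed {q : E × E | q.2 ∈ BoundedSubgrad S h C q.1} := by
  have hT : IsClosed (S ×ˢ (univ : Set E)) := hS.prod isClosed_univ
  have hEq : {q : E × E | q.2 ∈ BoundedSubgrad S h C q.1} =
      (S ×ˢ univ) ∩ {q | ‖q.2‖ ≤ C} ∩
        ⋂ y ∈ S, (S ×ˢ univ) ∩ (fun q : E × E => h q.1 + (⟪q.2, y - q.1⟫ : ℝ)) ⁻¹' Iic (h y) := by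
    ext q
    simp only [BoundedSubgrad, mem_ofPred_eq, mem_inter_iff, mem_prod, mem_univ, and_true,
      mem_iInter, mem_preimage, mem_Iic]
    exact ⟨fun hq => ⟨⟨hq.1, hq.2.1⟩, fun y hy => ⟨hq.1, hq.2.2 y hy⟩⟩,
      fun hq => ⟨hq.1.1, hq.1.2, fun y hy => (hq.2 y hy).2⟩⟩
  rw [hEq]
  refine (hT.inter (isClosed_le (by fun_prop) (by fun_prop))).inter
    (isClosed_biInter fun y _ => ?_)
  refine ContinuousOn.preimage_isClosed_of_isClosed ?_ hT isClosed_Iic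
  refine (hh.comp continuousOn_fst fun q hq => hq.1).add ?_
  exact Continuous.continuousOn (by fun_prop)

/-- Chain rule for subgradients along a curve staying in the domain. -/
lemma inner_eq_of_hasDerivAt_of_subgrad {S : Set E} {h : E → ℝ} {y : ℝ → E} (hyS : ∀ t, y t ∈ S)
    {t c : ℝ} {p s : E} (hp : HasDerivAt y p t) (hc : HasDerivAt (fun u => h (y u)) c t)
    (hs : ∀ z ∈ S, h (y t) + ⟪s, z - y t⟫ ≤ h z) : (⟪s, p⟫ : ℝ) = c := by
  have hd : HasDerivAt (fun u => h (y u) - (⟪s, y u⟫ : ℝ)) (c - ⟪s, p⟫) t :=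
    hc.sub ((innerSL ℝ s).hasFDerivAt.comp_hasDerivAt t hp)
  have hmin : IsLocalMin (fun u => h (y u) - (⟪s, y u⟫ : ℝ)) t :=
    Eventually.of_forall fun u => by
      have := hs (y u) (hyS u)
      rw [inner_sub_right] at this
      simp only
      linarith
  linarith [hmin.hasDerivAt_eq_zero hd]

end Fields

section Chain

open Filter Topology Set
open scoped NNReal

lemma LocallyLipschitzOn.comp_lipschitzWith {X : Type*} [PseudoEMetricSpace X]
    {S : Set X} {h : X → ℝ} (hh : LocallyLipschitzOn S h)
    {K : ℝ≥0} {y : ℝ → X} (hy : LipschitzWith K y) (hyS : ∀ t, y t ∈ S) :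
    LocallyLipschitz fun t => h (y t) := by
  intro t
  obtain ⟨L, U, hU, hL⟩ := hh (hyS t)
  refine ⟨L * K, y ⁻¹' U, ?_, hL.comp hy.lipschitzOnWith (mapsTo_preimage _ _)⟩
  exact (tendsto_nhdsWithin_iff.2 ⟨hy.continuous.continuousAt, Eventually.of_forall hyS⟩) hU

/-- Along a Lipschitz curve in `S`, at almost every time each `D i` and the subdifferential of `h`
compute the derivative of `f i` and of `h` respectively. -/
lemma ae_exists_chain_rule {d N : ℕ} {f : Fin N → Euc d → ℝ} {D : Fin N → Euc d → Set (Euc d)}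
    (hD : ∀ i, IsConservativeFieldR (D i) (f i)) (hne : ∀ i x, (D i x).Nonempty)
    {S : Set (Euc d)} {h : Euc d → ℝ} (hh : LocallyLipschitzOn S h)
    {K : ℝ≥0} {y : ℝ → Euc d} (hy : LipschitzWith K y) (hyS : ∀ t, y t ∈ S) :
    ∀ᵐ t ∂volume, t ∈ Ioo (0:ℝ) 1 → ∃ (p : Euc d) (c : Fin N → ℝ) (e : ℝ),
      HasDerivAt y p t ∧
      (∀ i, HasDerivAt (fun s => f i (y s)) (c i) t ∧ ∀ v ∈ D i (y t), (⟪v, p⟫ : ℝ) = c i) ∧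
      HasDerivAt (fun s => h (y s)) e t ∧
      ∀ C, ∀ s ∈ BoundedSubgrad S h C (y t), (⟪s, p⟫ : ℝ) = e := by
  have hD' := ae_all_iff.2 fun i => (hD i).2 y (deriv y) hy.eq_add_integral_deriv.1
    hy.eq_add_integral_deriv.2 fun t _ => hne i _
  have hhd := ((hh.comp_lipschitzWith hy hyS).absolutelyContinuousOnInterval 0 1).ae_differentiableAt
  filter_upwards [hD', hhd, hy.ae_differentiableAt] with t h1 h2 h3 ht
  have ht' : t ∈ uIcc (0:ℝ) 1 := by
    rw [uIcc_of_le zero_le_one]; exact Ioo_subset_Icc_self ht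
  have hder := fun i => h1 i ht
  choose v hv using fun i => hne i (y t)
  refine ⟨deriv y t, fun i => ⟪v i, deriv y t⟫, deriv (fun s => h (y s)) t, h3.hasDerivAt,
    fun i => ⟨hder i _ (hv i), fun w hw => (hder i w hw).unique (hder i _ (hv i))⟩,
    (h2 ht').hasDerivAt, fun C s hs => ?_⟩
  exact inner_eq_of_hasDerivAt_of_subgrad hyS h3.hasDerivAt (h2 ht').hasDerivAt hs.2.2

end Chain

section Limit

open Filter Topology Set
open scoped NNReal

lemma norm_sub_le_mul_sum_sub {E : Type*} [NormedAddCommGroup E]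
    {C : ℝ} {a : ℕ → ℝ} {x : ℕ → E} {m j k : ℕ}
    (hstep : ∀ i < m, ‖x (i + 1) - x i‖ ≤ C * a i) (hjk : j ≤ k) (hk : k ≤ m) :
    ‖x k - x j‖ ≤ C * (∑ i ∈ Finset.range k, a i - ∑ i ∈ Finset.range j, a i) := by
  induction k, hjk using Nat.le_induction with
  | base => simp
  | succ k hjk ih =>
    have h1 := ih (by omega)
    have h2 := hstep k (by omega)
    have h3 := norm_sub_le_norm_sub_add_norm_sub (x (k + 1)) (x k) (x j)
    rw [Finset.sum_range_succ]
    linarith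

variable {E : Type*} [NormedAddCommGroup E] [InnerProductSpace ℝ E]

lemma abs_inner_sub_add_sum_sub_mul_le {c ε : ℝ} {p : E} {a : ℕ → ℝ} {x : ℕ → E} {j k : ℕ}
    (hjk : j ≤ k)
    (hstep : ∀ i, j ≤ i → i < k → |(⟪x (i + 1) - x i, p⟫ : ℝ) + a i * c| ≤ a i * ε) :
    |(⟪x k - x j, p⟫ : ℝ) + (∑ i ∈ Finset.range k, a i - ∑ i ∈ Finset.range j, a i) * c| ≤
      (∑ i ∈ Finset.range k, a i - ∑ i ∈ Finset.range j, a i) * ε := by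
  induction k, hjk using Nat.le_induction with
  | base => simp
  | succ k hjk ih =>
    have h1 := ih fun i hi hik => hstep i hi (by omega)
    have h2 := hstep k hjk (by omega)
    have h3 : x (k + 1) - x j = (x (k + 1) - x k) + (x k - x j) := by abel
    rw [Finset.sum_range_succ, h3, inner_add_left]
    rw [abs_le] at *
    constructor <;> linarith [h1.1, h1.2, h2.1, h2.2]

/-- Pointwise limits of rescaled discrete trajectories satisfy the limiting energy identity at
every point of differentiability. -/
lemma sq_norm_eq_of_tendsto_discrete {ω : Filter ℕ} [NeBot ω] {P : ℝ → E → E → Prop} {C : ℝ}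
    (hC : 0 ≤ C) (hP : ∀ a x x', P a x x' → ‖x' - x‖ ≤ C * a)
    {a : ℕ → ℕ → ℝ} {x : ℕ → ℕ → E} {m : ℕ → ℕ} {J : ℕ → ℝ → ℕ} {b τ : ℕ → ℝ} {τ₀ : ℝ}
    (hJ : ∀ n, Monotone (J n)) (hJm : ∀ n s, J n s ≤ m n)
    (hJt : ∀ n, ∀ s ∈ Icc (0:ℝ) 1, |∑ i ∈ Finset.range (J n s), a n i - τ n * s| ≤ b n)
    (hb : Tendsto b ω (𝓝 0)) (hτ : Tendsto τ ω (𝓝 τ₀))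
    (ha : ∀ n, ∀ j < m n, 0 ≤ a n j ∧ a n j ≤ b n)
    (hstep : ∀ n, ∀ j < m n, P (a n j) (x n j) (x n (j + 1)))
    {y : ℝ → E} (hy : ∀ s ∈ Icc (0:ℝ) 1, Tendsto (fun n => x n (J n s)) ω (𝓝 (y s)))
    {t c : ℝ} {p : E} (ht : t ∈ Ioo (0:ℝ) 1) (hp : HasDerivAt y p t)
    (hloc : ∀ ε > 0, ∃ δ > 0, ∀ a x x', 0 ≤ a → P a x x' → C * a < δ → ‖x - y t‖ < δ →
      |(⟪x' - x, p⟫ : ℝ) + a * c| ≤ a * ε) :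
    ‖p‖ ^ 2 = -(τ₀ * c) := by
  have htI : t ∈ Icc (0:ℝ) 1 := Ioo_subset_Icc_self ht
  have main : ∀ ε > 0, |‖p‖ ^ 2 + τ₀ * c| ≤ τ₀ * ε := by
    intro ε hε
    obtain ⟨δ, hδ, hδP⟩ := hloc ε hε
    have hsmall : ∀ᶠ s in 𝓝[>] t, s ∈ Ioc t 1 ∧ C * (τ₀ * (s - t)) < δ / 2 := by
      have h1 : ∀ᶠ s in 𝓝[>] t, s ∈ Ioc t 1 := Ioc_mem_nhdsGT ht.2
      have h2 : Tendsto (fun s => C * (τ₀ * (s - t))) (𝓝[>] t) (𝓝 0) :=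
        ((by fun_prop : Continuous fun s => C * (τ₀ * (s - t))).tendsto' t 0 (by simp)).mono_left
          nhdsWithin_le_nhds
      exact h1.and (h2.eventually_lt_const (by linarith))
    have hineq : ∀ᶠ s in 𝓝[>] t,
        |(⟪(s - t)⁻¹ • (y s - y t), p⟫ : ℝ) + τ₀ * c| ≤ τ₀ * ε := by
      filter_upwards [hsmall] with s hs
      have hst : 0 < s - t := sub_pos.2 hs.1.1
      have hsI : s ∈ Icc (0:ℝ) 1 := ⟨ht.1.le.trans hs.1.1.le, hs.1.2⟩
      have hJst : ∀ n, J n t ≤ J n s := fun n => hJ n hs.1.1.le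
      set Δ : ℕ → ℝ := fun n =>
        ∑ i ∈ Finset.range (J n s), a n i - ∑ i ∈ Finset.range (J n t), a n i with hΔdef
      have hΔ : Tendsto Δ ω (𝓝 (τ₀ * (s - t))) := by
        have h1 : Tendsto (fun n => Δ n - τ n * (s - t)) ω (𝓝 0) := by
          refine squeeze_zero_norm (a := fun n => 2 * b n) (fun n => ?_) (by simpa using hb.const_mul 2)
          have h1 := abs_le.1 (hJt n s hsI)
          have h2 := abs_le.1 (hJt n t htI)
          rw [Real.norm_eq_abs, abs_le]
          constructor <;> simp only [hΔdef] <;> linarith [h1.1, h1.2, h2.1, h2.2]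
        simpa using h1.add (hτ.mul_const (s - t))
      have hlim : Tendsto (fun n => |(⟪x n (J n s) - x n (J n t), p⟫ : ℝ) + Δ n * c|) ω
          (𝓝 |(⟪y s - y t, p⟫ : ℝ) + τ₀ * (s - t) * c|) :=
        ((((hy s hsI).sub (hy t htI)).inner tendsto_const_nhds).add (hΔ.mul_const c)).abs
      have hfin := le_of_tendsto_of_tendsto hlim (hΔ.mul_const ε) (by
        have hCb : Tendsto (fun n => C * b n) ω (𝓝 0) := by simpa using hb.const_mul C
        filter_upwards [(hΔ.const_mul C).eventually_lt_const hs.2,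
          hCb.eventually_lt_const hδ,
          (tendsto_iff_norm_sub_tendsto_zero.1 (hy t htI)).eventually_lt_const (half_pos hδ)]
          with n h1 h2 h3
        refine abs_inner_sub_add_sum_sub_mul_le (hJst n) fun i hji hik => ?_
        have him : i < m n := hik.trans_le (hJm n s)
        refine hδP _ _ _ (ha n i him).1 (hstep n i him)
          ((mul_le_mul_of_nonneg_left (ha n i him).2 hC).trans_lt h2) ?_
        have h4 := norm_sub_le_mul_sum_sub (fun i hi => hP _ _ _ (hstep n i hi)) hji him.le
        have h5 : ∑ l ∈ Finset.range i, a n l ≤ ∑ l ∈ Finset.range (J n s), a n l :=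
          Finset.sum_le_sum_of_subset_of_nonneg (Finset.range_mono hik.le) fun l hl _ =>
            (ha n l ((Finset.mem_range.1 hl).trans_le (hJm n s))).1
        have h6 : ‖x n i - x n (J n t)‖ ≤ C * Δ n :=
          h4.trans (mul_le_mul_of_nonneg_left (by simp only [hΔdef]; linarith) hC)
        linarith [norm_sub_le_norm_sub_add_norm_sub (x n i) (x n (J n t)) (y t)])
      rw [real_inner_smul_left]
      have hrew : (s - t)⁻¹ * (⟪y s - y t, p⟫ : ℝ) + τ₀ * c =
          (s - t)⁻¹ * ((⟪y s - y t, p⟫ : ℝ) + τ₀ * (s - t) * c) := by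
        field_simp
      rw [hrew, abs_mul, abs_of_pos (inv_pos.2 hst)]
      calc (s - t)⁻¹ * |(⟪y s - y t, p⟫ : ℝ) + τ₀ * (s - t) * c|
          ≤ (s - t)⁻¹ * (τ₀ * (s - t) * ε) := by gcongr
        _ = τ₀ * ε := by field_simp
    have hslope : Tendsto (fun s => (s - t)⁻¹ • (y s - y t)) (𝓝[>] t) (𝓝 p) := by
      have := (hasDerivAt_iff_tendsto_slope.1 hp).mono_left
        (nhdsWithin_mono t fun s (hs : t < s) => hs.ne')
      simpa [slope_fun_def, vsub_eq_sub] using! this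
    have hl := ((hslope.inner (tendsto_const_nhds (x := p))).add_const (τ₀ * c)).abs
    have := le_of_tendsto hl hineq
    rwa [real_inner_self_eq_norm_sq] at this
  have h0 : |‖p‖ ^ 2 + τ₀ * c| ≤ 0 := by
    refine ge_of_tendsto (f := fun ε : ℝ => τ₀ * ε) (x := 𝓝[>] 0) ?_ ?_
    · exact ((continuous_const.mul continuous_id).tendsto' 0 0 (by simp)).mono_left
        nhdsWithin_le_nhds
    · filter_upwards [self_mem_nhdsWithin] with ε hε using main ε hε
  have := abs_nonpos_iff.1 h0
  linarith

end Limit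

section Steps

open Filter Topology Set
open scoped NNReal

variable {E : Type*} [NormedAddCommGroup E] [InnerProductSpace ℝ E]

/-- A step from `x` to `x'` along elements of `D i` taken within `C * a` of `x` and an element of
`G x'`. -/
def IsApproxStep {N : ℕ} (D : Fin N → E → Set E) (G : E → Set E) (C a : ℝ) (x x' : E) : Prop :=
  ‖x' - x‖ ≤ C * a ∧ ∃ (v z : Fin N → E) (s : E),
    (∀ i, v i ∈ D i (z i) ∧ ‖z i - x‖ ≤ C * a) ∧ s ∈ G x' ∧ x' - x = -(a • (∑ i, v i + s))

lemma exists_forall_abs_inner_step_le {N : ℕ} {D : Fin N → E → Set E} {G : E → Set E} {x₀ p : E}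
    {c : Fin N → ℝ} {e : ℝ}
    (hD : ∀ i, ∀ ε > 0, ∀ᶠ y in 𝓝 x₀, ∀ v ∈ D i y, |(⟪v, p⟫ : ℝ) - c i| < ε)
    (hG : ∀ ε > 0, ∀ᶠ y in 𝓝 x₀, ∀ v ∈ G y, |(⟪v, p⟫ : ℝ) - e| < ε) (C : ℝ) :
    ∀ ε > 0, ∃ δ > 0, ∀ a x x', 0 ≤ a → IsApproxStep D G C a x x' → C * a < δ → ‖x - x₀‖ < δ →
      |(⟪x' - x, p⟫ : ℝ) + a * (∑ i, c i + e)| ≤ a * ε := by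
  intro ε hε
  have hN : (0 : ℝ) < N + 1 := by positivity
  have hε' : 0 < ε / (N + 1) := by positivity
  obtain ⟨δ, hδ, hball⟩ := Metric.eventually_nhds_iff.1
    ((eventually_all.2 fun i => hD i _ hε').and (hG _ hε'))
  refine ⟨δ / 2, half_pos hδ, ?_⟩
  rintro a x x' ha ⟨hxx', v, z, s, hv, hs, heq⟩ hCa hx
  have hz : ∀ w, ‖w - x‖ ≤ C * a → dist w x₀ < δ := fun w hw => by
    rw [dist_eq_norm]
    linarith [norm_sub_le_norm_sub_add_norm_sub w x x₀]
  have h1 : ∀ i, |(⟪v i, p⟫ : ℝ) - c i| ≤ ε / (N + 1) := fun i =>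
    ((hball (hz _ (hv i).2)).1 i _ (hv i).1).le
  have h2 : |(⟪s, p⟫ : ℝ) - e| ≤ ε / (N + 1) := ((hball (hz _ hxx')).2 _ hs).le
  have h3 : (⟪x' - x, p⟫ : ℝ) + a * (∑ i, c i + e) =
      -(a * (∑ i, ((⟪v i, p⟫ : ℝ) - c i) + (⟪s, p⟫ - e))) := by
    rw [heq, inner_neg_left, real_inner_smul_left, inner_add_left, sum_inner,
      Finset.sum_sub_distrib]
    ring
  rw [h3, abs_neg, abs_mul, abs_of_nonneg ha]
  refine mul_le_mul_of_nonneg_left ?_ ha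
  calc |∑ i, ((⟪v i, p⟫ : ℝ) - c i) + (⟪s, p⟫ - e)|
      ≤ ∑ i, |(⟪v i, p⟫ : ℝ) - c i| + |⟪s, p⟫ - e| :=
        (abs_add_le _ _).trans (add_le_add_left (Finset.abs_sum_le_sum_abs _ _) _)
    _ ≤ ∑ _i : Fin N, ε / (N + 1) + ε / (N + 1) :=
        add_le_add (Finset.sum_le_sum fun i _ => h1 i) h2
    _ = ε := by
        simp only [Finset.sum_const, Finset.card_univ, Fintype.card_fin, nsmul_eq_mul]
        field_simp

/-- Optimality condition of the proximal step. -/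
lemma subgrad_of_prox {S : Set E} {h : E → ℝ} (hconv : ConvexOn ℝ S h) {α : ℝ} (hα : 0 < α)
    {z x : E} (hx : x ∈ S)
    (hmin : ∀ w ∈ S, h x + ‖x - z‖ ^ 2 / (2 * α) ≤ h w + ‖w - z‖ ^ 2 / (2 * α)) :
    ∀ y ∈ S, h x + (⟪α⁻¹ • (z - x), y - x⟫ : ℝ) ≤ h y := by
  intro y hy
  have key : ∀ᶠ θ : ℝ in 𝓝[>] 0,
      h x + (⟪α⁻¹ • (z - x), y - x⟫ : ℝ) - h y ≤ θ * (‖y - x‖ ^ 2 / (2 * α)) := by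
    filter_upwards [Ioo_mem_nhdsGT (zero_lt_one (α := ℝ))] with θ hθ
    have hw := hconv.1 hx hy (sub_nonneg.2 hθ.2.le) hθ.1.le (by ring)
    have hhw := hconv.2 hx hy (sub_nonneg.2 hθ.2.le) hθ.1.le (by ring)
    have h1 := hmin _ hw
    have h2 : (1 - θ) • x + θ • y - z = (x - z) + θ • (y - x) := by module
    rw [h2, norm_add_sq_real, real_inner_smul_right, norm_smul, Real.norm_eq_abs, mul_pow,
      sq_abs] at h1
    have h3 : (⟪α⁻¹ • (z - x), y - x⟫ : ℝ) = -(α⁻¹ * ⟪x - z, y - x⟫) := by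
      rw [real_inner_smul_left, ← neg_sub x z, inner_neg_left]; ring
    rw [h3]
    simp only [smul_eq_mul] at hhw
    have h4 : (‖x - z‖ ^ 2 + 2 * (θ * (⟪x - z, y - x⟫ : ℝ)) + θ ^ 2 * ‖y - x‖ ^ 2) / (2 * α) =
        ‖x - z‖ ^ 2 / (2 * α) + θ * (α⁻¹ * ⟪x - z, y - x⟫) +
          θ * (θ * (‖y - x‖ ^ 2 / (2 * α))) := by
      field_simp
    rw [h4] at h1
    refine le_of_mul_le_mul_left ?_ hθ.1
    linarith
  have hlim : Tendsto (fun θ : ℝ => θ * (‖y - x‖ ^ 2 / (2 * α))) (𝓝[>] 0) (𝓝 0) :=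
    ((continuous_id.mul continuous_const).tendsto' 0 0 (by simp)).mono_left nhdsWithin_le_nhds
  linarith [ge_of_tendsto hlim key]

/-- A convex locally Lipschitz function decreases at most linearly from points of a compact set. -/
lemma exists_forall_sub_le_mul_norm_sub [ProperSpace E] {S : Set E} (hS : IsClosed S) {h : E → ℝ}
    (hconv : ConvexOn ℝ S h) (hlip : LocallyLipschitzOn S h) (R : ℝ) :
    ∃ L ≥ 0, ∀ p ∈ S ∩ Metric.closedBall 0 R, ∀ q ∈ S, h p - h q ≤ L * ‖p - q‖ := by
  refine ((isCompact_closedBall (0 : E) R).inter_left hS).induction_on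
    (p := fun A => ∃ L ≥ 0, ∀ p ∈ A, ∀ q ∈ S, h p - h q ≤ L * ‖p - q‖) ⟨0, le_rfl, by simp⟩ ?_ ?_ ?_
  · rintro s t hst ⟨L, hL, hLt⟩
    exact ⟨L, hL, fun p hp => hLt p (hst hp)⟩
  · rintro s t ⟨L, hL, hLs⟩ ⟨M, hM, hMt⟩
    refine ⟨L + M, add_nonneg hL hM, ?_⟩
    rintro p (hp | hp) q hq
    · nlinarith [hLs p hp q hq, norm_nonneg (p - q)]
    · nlinarith [hMt p hp q hq, norm_nonneg (p - q)]
  · rintro x₀ ⟨hx₀, -⟩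
    obtain ⟨K, U, hU, hK⟩ := hlip hx₀
    obtain ⟨ε, hε, hεU⟩ := Metric.mem_nhdsWithin_iff.1 hU
    refine ⟨Metric.ball x₀ ε ∩ S, ?_, K, K.2, ?_⟩
    · exact mem_of_superset (inter_mem
        (mem_nhdsWithin_of_mem_nhds (Metric.ball_mem_nhds x₀ hε)) self_mem_nhdsWithin)
        fun y hy => ⟨hy.1, hy.2.1⟩
    · rintro p ⟨hpb, hpS⟩ q hq
      have hcont : Tendsto (fun θ : ℝ => (1 - θ) • p + θ • q) (𝓝[>] 0) (𝓝 p) :=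
        ((by fun_prop : Continuous fun θ : ℝ => (1 - θ) • p + θ • q).tendsto' 0 p
          (by simp)).mono_left nhdsWithin_le_nhds
      obtain ⟨θ, hθb, hθ⟩ := ((hcont.eventually (Metric.isOpen_ball.mem_nhds hpb)).and
        (Ioo_mem_nhdsGT (zero_lt_one (α := ℝ)))).exists
      have hw := hconv.1 hpS hq (sub_nonneg.2 hθ.2.le) hθ.1.le (by ring)
      have hhw := hconv.2 hpS hq (sub_nonneg.2 hθ.2.le) hθ.1.le (by ring)
      have h1 := hK.dist_le_mul _ (hεU ⟨hpb, hpS⟩) _ (hεU ⟨hθb, hw⟩)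
      have h2 : p - ((1 - θ) • p + θ • q) = θ • (p - q) := by module
      rw [Real.dist_eq, dist_eq_norm, h2, norm_smul, Real.norm_of_nonneg hθ.1.le] at h1
      have h3 := (le_abs_self _).trans h1
      simp only [smul_eq_mul] at hhw
      refine le_of_mul_le_mul_left ?_ hθ.1
      linarith

lemma exists_forall_norm_le_of_locBounded {d : ℕ} {F : Euc d → Set (Euc d)} (hF : LocBounded F)
    (R : ℝ) : ∃ B ≥ 0, ∀ y ∈ Metric.closedBall (0 : Euc d) R, ∀ v ∈ F y, ‖v‖ ≤ B := by
  refine (isCompact_closedBall (0 : Euc d) R).induction_on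
    (p := fun A => ∃ B ≥ 0, ∀ y ∈ A, ∀ v ∈ F y, ‖v‖ ≤ B) ⟨0, le_rfl, by simp⟩ ?_ ?_ ?_
  · rintro s t hst ⟨B, hB, hBt⟩
    exact ⟨B, hB, fun p hp => hBt p (hst hp)⟩
  · rintro s t ⟨L, hL, hLs⟩ ⟨M, hM, hMt⟩
    refine ⟨L + M, add_nonneg hL hM, ?_⟩
    rintro y (hy | hy) v hv
    · linarith [hLs y hy v hv]
    · linarith [hMt y hy v hv]
  · intro x₀ _
    obtain ⟨ε, hε, hb⟩ := hF x₀
    obtain ⟨B, hB, hBle⟩ := hb.exists_pos_norm_le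
    exact ⟨Metric.ball x₀ ε, mem_nhdsWithin_of_mem_nhds (Metric.ball_mem_nhds x₀ hε), B, hB.le,
      fun y hy v hv => hBle v (mem_biUnion hy hv)⟩

/-- From points of a bounded set, a proximal random reshuffling step with small step size `α` moves
by at most a multiple of `α`, along subgradients of uniformly bounded norm. -/
lemma exists_isApproxStep {d N : ℕ} {D : Fin N → Euc d → Set (Euc d)} (hD : ∀ i, LocBounded (D i))
    {S : Set (Euc d)} (hS : IsClosed S) {h : Euc d → ℝ} (hconv : ConvexOn ℝ S h)
    (hlip : LocallyLipschitzOn S h) (R : ℝ) :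
    ∃ C ≥ 0, ∃ a₀ > 0, ∀ (α : ℝ) (x x' : Euc d) (σ : Equiv.Perm (Fin N)) (z : ℕ → Euc d),
      0 < α → α ≤ a₀ → x ∈ S → ‖x‖ ≤ R → z 0 = x →
      (∀ i : Fin N, ∃ v ∈ D (σ i) (z i.1), z (i.1 + 1) = z i.1 - α • v) → x' ∈ S →
      (∀ w ∈ S, h x' + ‖x' - z N‖ ^ 2 / (2 * α) ≤ h w + ‖w - z N‖ ^ 2 / (2 * α)) →
      IsApproxStep D (BoundedSubgrad S h C) C α x x' := by
  obtain ⟨L, hL, hLS⟩ := exists_forall_sub_le_mul_norm_sub hS hconv hlip R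
  choose B' hB'0 hB' using fun i => exists_forall_norm_le_of_locBounded (hD i) (R + 1)
  set B := ∑ i, B' i with hBdef
  have hB0 : 0 ≤ B := Finset.sum_nonneg fun i _ => hB'0 i
  have hB : ∀ i, ∀ y ∈ Metric.closedBall (0 : Euc d) (R + 1), ∀ v ∈ D i y, ‖v‖ ≤ B :=
    fun i y hy v hv => (hB' i y hy v hv).trans
      (Finset.single_le_sum (fun i _ => hB'0 i) (Finset.mem_univ i))
  have hNB : 0 ≤ N * B := by positivity
  refine ⟨2 * (N * B) + L, by positivity, 1 / (N * B + 1), by positivity, ?_⟩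
  intro α x x' σ z hα hαle hx hxR hz0 hstep hx' hmin
  have hNBα : N * B * α ≤ 1 := by
    rw [le_div_iff₀ (by positivity)] at hαle
    linarith
  have hz : ∀ i ≤ N, ‖z i - x‖ ≤ i * B * α := by
    intro i hi
    induction i with
    | zero => simp [hz0]
    | succ i ih =>
      have h1 := ih (by omega)
      obtain ⟨v, hv, hzv⟩ := hstep ⟨i, hi⟩
      simp only at hv hzv
      have h2 : (i : ℝ) * B * α ≤ N * B * α := by
        have : (i : ℝ) ≤ N := by exact_mod_cast (by omega : i ≤ N)
        gcongr
      have h3 : ‖v‖ ≤ B := hB _ (z i) (by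
        rw [mem_closedBall_zero_iff]
        linarith [norm_le_norm_add_norm_sub' (z i) x]) v hv
      have h4 : z (i + 1) - x = (z i - x) - α • v := by rw [hzv]; abel
      rw [h4]
      have h5 := norm_sub_le (z i - x) (α • v)
      rw [norm_smul, Real.norm_of_nonneg hα.le] at h5
      push_cast
      nlinarith [mul_le_mul_of_nonneg_left h3 hα.le]
  choose v hv hzv using hstep
  have hsum : z N = x - α • ∑ i, v i := by
    have h1 := Fin.sum_univ_eq_sum_range (fun i => z (i + 1) - z i) N
    rw [Finset.sum_range_sub, hz0] at h1
    rw [Finset.smul_sum, sub_eq_add_neg, ← Finset.sum_neg_distrib, ← sub_eq_iff_eq_add', ← h1]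
    exact Finset.sum_congr rfl fun i _ => by rw [hzv i]; abel
  have hsub := subgrad_of_prox hconv hα hx' hmin
  have hzN := hz N le_rfl
  have hdist : ‖x' - x‖ ≤ (N * B + L) * α := by
    have h1 := hsub x hx
    have h2 := hLS x ⟨hx, by simpa using hxR⟩ x' hx'
    have h3 : α⁻¹ * (⟪z N - x', x - x'⟫ : ℝ) ≤ L * ‖x - x'‖ := by
      rw [real_inner_smul_left] at h1; linarith
    rw [inv_mul_le_iff₀ hα] at h3
    have h4 : z N - x' = (z N - x) + (x - x') := by abel
    rw [h4, inner_add_left, real_inner_self_eq_norm_sq] at h3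
    have h5 := (abs_le.1 (abs_real_inner_le_norm (z N - x) (x - x'))).1
    rw [norm_sub_rev]
    rcases (norm_nonneg (x - x')).eq_or_lt with h0 | h0
    · rw [← h0]; positivity
    · refine le_of_mul_le_mul_right ?_ h0
      nlinarith [mul_le_mul_of_nonneg_right hzN h0.le]
  refine ⟨hdist.trans (by nlinarith), fun i => v (σ.symm i), fun i => z (σ.symm i),
    α⁻¹ • (z N - x'), fun i => ⟨?_, ?_⟩, ⟨hx', ?_, hsub⟩, ?_⟩
  · simpa using hv (σ.symm i)
  · refine (hz _ (σ.symm i).2.le).trans ?_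
    have : ((σ.symm i : ℕ) : ℝ) ≤ N := by exact_mod_cast (σ.symm i).2.le
    have : ((σ.symm i : ℕ) : ℝ) * B * α ≤ N * B * α := by gcongr
    nlinarith
  · rw [norm_smul, norm_inv, Real.norm_of_nonneg hα.le, inv_mul_le_iff₀ hα]
    have h1 := norm_sub_le_norm_sub_add_norm_sub (z N) x x'
    rw [norm_sub_rev x x'] at h1
    nlinarith
  · rw [smul_add, smul_inv_smul₀ hα.ne', Equiv.sum_comp σ.symm v, hsum]
    abel

end Steps

section Compactness

open Filter Topology Set
open scoped NNReal

/-- Rescaled time of a finite sequence of steps, as a monotone index function on `[0, 1]`. -/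
lemma exists_monotone_time_index {a : ℕ → ℝ} {m : ℕ} {b : ℝ} (hb : 0 ≤ b)
    (ha : ∀ j < m, 0 < a j ∧ a j ≤ b) :
    ∃ J : ℝ → ℕ, Monotone J ∧ (∀ s, J s ≤ m) ∧ J 0 = 0 ∧ J 1 = m ∧ ∀ s ∈ Icc (0:ℝ) 1,
      |∑ i ∈ Finset.range (J s), a i - (∑ i ∈ Finset.range m, a i) * s| ≤ b := by
  classical
  set τ := ∑ i ∈ Finset.range m, a i with hτ
  have hτ0 : 0 ≤ τ := Finset.sum_nonneg fun i hi => (ha i (Finset.mem_range.1 hi)).1.le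
  set J : ℝ → ℕ := fun s => Nat.findGreatest (fun j => ∑ i ∈ Finset.range j, a i ≤ τ * s) m with hJ
  have hJm : ∀ s, J s ≤ m := fun s => Nat.findGreatest_le m
  have hspec : ∀ s, 0 ≤ s → ∑ i ∈ Finset.range (J s), a i ≤ τ * s := fun s hs =>
    Nat.findGreatest_spec (P := fun j => ∑ i ∈ Finset.range j, a i ≤ τ * s) (Nat.zero_le m)
      (by simpa using mul_nonneg hτ0 hs)
  refine ⟨J, fun s s' hss' => ?_, hJm, ?_, ?_, fun s hs => ?_⟩
  · exact Nat.findGreatest_mono_left (fun j hj => hj.trans (by gcongr)) m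
  · by_contra hne
    have h1 := hspec 0 le_rfl
    rw [mul_zero] at h1
    have h2 : 0 < ∑ i ∈ Finset.range (J 0), a i :=
      Finset.sum_pos (fun i hi => (ha i ((Finset.mem_range.1 hi).trans_le (hJm 0))).1)
        ⟨0, Finset.mem_range.2 (Nat.pos_of_ne_zero hne)⟩
    linarith
  · exact le_antisymm (hJm 1) (Nat.le_findGreatest le_rfl (by rw [mul_one]))
  · have h1 := hspec s hs.1
    rw [abs_le]
    refine ⟨?_, by linarith⟩
    rcases (hJm s).eq_or_lt with h2 | h2
    · rw [h2, ← hτ]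
      nlinarith [hs.2]
    · have h3 := Nat.findGreatest_is_greatest (Nat.lt_succ_self (J s)) h2
      rw [not_le, Nat.succ_eq_add_one, Finset.sum_range_succ] at h3
      linarith [(ha _ h2).2]

lemma IsCompact.exists_tendsto_ultrafilter {X ι : Type*} [TopologicalSpace X] {K : Set X}
    (hK : IsCompact K) (ω : Ultrafilter ι) {u : ι → X} (hu : ∀ i, u i ∈ K) :
    ∃ v ∈ K, Tendsto u ω (𝓝 v) :=
  hK.ultrafilter_le_nhds (ω.map u) (le_principal_iff.2 (Filter.mem_map.2 (univ_mem' hu)))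

/-- Energy inequality between the limits of the endpoints of bounded discrete trajectories with
vanishing step sizes. -/
lemma exists_tendsto_endpoints {d N : ℕ} {f : Fin N → Euc d → ℝ} (hf : ∀ i, LocallyLipschitz (f i))
    {D : Fin N → Euc d → Set (Euc d)} (hD : ∀ i, IsConservativeFieldR (D i) (f i))
    (hDb : ∀ i, LocBounded (D i)) (hne : ∀ i x, (D i x).Nonempty)
    {S : Set (Euc d)} (hS : IsClosed S) {h : Euc d → ℝ} (hlip : LocallyLipschitzOn S h)
    {C R T : ℝ} (hC : 0 ≤ C) {α : ℕ → ℕ → ℝ} {x : ℕ → ℕ → Euc d} {m : ℕ → ℕ} {b : ℕ → ℝ}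
    (hb0 : ∀ n, 0 ≤ b n) (hb : Tendsto b atTop (𝓝 0))
    (hα : ∀ n, ∀ j < m n, 0 < α n j ∧ α n j ≤ b n)
    (hT : ∀ n, ∑ j ∈ Finset.range (m n), α n j ≤ T)
    (hstep : ∀ n, ∀ j < m n,
      IsApproxStep D (BoundedSubgrad S h C) C (α n j) (x n j) (x n (j + 1)))
    (hxS : ∀ n, ∀ j ≤ m n, x n j ∈ S) (hxR : ∀ n, ∀ j ≤ m n, ‖x n j‖ ≤ R) :
    ∃ (ω : Ultrafilter ℕ) (y₀ y₁ : Euc d) (τ : ℝ), y₀ ∈ S ∧ y₁ ∈ S ∧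
      Tendsto (fun n => x n 0) ω (𝓝 y₀) ∧ Tendsto (fun n => x n (m n)) ω (𝓝 y₁) ∧
      0 ≤ τ ∧ τ ≤ T ∧
      ‖y₁ - y₀‖ ^ 2 ≤ τ * ((∑ i, f i y₀ + h y₀) - (∑ i, f i y₁ + h y₁)) := by
  set ω : Ultrafilter ℕ := hyperfilter ℕ
  have hbω : Tendsto b ω (𝓝 0) := hb.mono_left Nat.hyperfilter_le_atTop
  choose J hJ hJm hJ0 hJ1 hJt using fun n => exists_monotone_time_index (hb0 n) (hα n)
  obtain ⟨τ, ⟨hτ0, hτT⟩, hτ⟩ := (isCompact_Icc (a := (0:ℝ)) (b := T)).exists_tendsto_ultrafilter ω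
    (u := fun n => ∑ j ∈ Finset.range (m n), α n j) fun n =>
      ⟨Finset.sum_nonneg fun j hj => (hα n j (Finset.mem_range.1 hj)).1.le, hT n⟩
  choose Y hYmem hY using fun s => ((isCompact_closedBall (0 : Euc d) R).inter_left
    hS).exists_tendsto_ultrafilter ω (u := fun n => x n (J n s)) fun n =>
      ⟨hxS n _ (hJm n s), by simpa using hxR n _ (hJm n s)⟩
  have hYlip : ∀ s ∈ Icc (0:ℝ) 1, ∀ s' ∈ Icc (0:ℝ) 1, s ≤ s' →
      ‖Y s' - Y s‖ ≤ C * (τ * (s' - s)) := by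
    intro s hs s' hs' hss'
    have hlim : Tendsto (fun n => C * ((∑ j ∈ Finset.range (m n), α n j) * (s' - s) + 2 * b n)) ω
        (𝓝 (C * (τ * (s' - s) + 2 * 0))) :=
      ((hτ.mul_const _).add (hbω.const_mul 2)).const_mul C
    rw [mul_zero, add_zero] at hlim
    refine le_of_tendsto_of_tendsto' ((hY s').sub (hY s)).norm hlim fun n => ?_
    refine (norm_sub_le_mul_sum_sub (fun i hi => (hstep n i hi).1) (hJ n hss') (hJm n s')).trans
      (mul_le_mul_of_nonneg_left ?_ hC)
    have h1 := abs_le.1 (hJt n s hs)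
    have h2 := abs_le.1 (hJt n s' hs')
    linarith [h1.1, h2.2]
  set y : ℝ → Euc d := fun s => Y (projIcc (0:ℝ) 1 zero_le_one s) with hydef
  have hyY : ∀ s ∈ Icc (0:ℝ) 1, y s = Y s := fun s hs => by
    simp only [hydef, projIcc_of_mem zero_le_one hs]
  have hyS : ∀ s, y s ∈ S := fun s => (hYmem _).1
  have hylip : LipschitzWith (C * τ).toNNReal y := by
    have hCτ := mul_nonneg hC hτ0
    refine LipschitzWith.of_dist_le_mul fun s s' => ?_
    have h1 := (LipschitzWith.projIcc (zero_le_one (α := ℝ))).dist_le_mul s s'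
    rw [NNReal.coe_one, one_mul, Subtype.dist_eq, Real.dist_eq] at h1
    refine le_trans ?_ (mul_le_mul_of_nonneg_left h1 (NNReal.coe_nonneg _))
    rw [dist_eq_norm]
    rcases le_total (projIcc (0:ℝ) 1 zero_le_one s) (projIcc (0:ℝ) 1 zero_le_one s') with hle | hle
    · rw [norm_sub_rev, abs_sub_comm, abs_of_nonneg (sub_nonneg.2 (Subtype.coe_le_coe.2 hle)),
        Real.coe_toNNReal _ hCτ, mul_assoc]
      exact hYlip _ (Subtype.prop _) _ (Subtype.prop _) hle
    · rw [abs_of_nonneg (sub_nonneg.2 (Subtype.coe_le_coe.2 hle)),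
        Real.coe_toNNReal _ hCτ, mul_assoc]
      exact hYlip _ (Subtype.prop _) _ (Subtype.prop _) hle
  have hac : AbsolutelyContinuousOnInterval (∑ i, (fun s => f i (y s)) + fun s => h (y s)) 0 1 :=
    (AbsolutelyContinuousOnInterval.finset_sum _ fun i _ =>
      ((hf i).comp hylip.locallyLipschitz).absolutelyContinuousOnInterval 0 1).add
      ((hlip.comp_lipschitzWith hylip hyS).absolutelyContinuousOnInterval 0 1)
  have henergy := sq_norm_sub_le_of_ae_sq_norm_deriv_le (τ := τ) hylip hac (by
    filter_upwards [ae_exists_chain_rule hD hne hlip hylip hyS] with t hchain ht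
    obtain ⟨p, c, e, hp, hc, he, hsub⟩ := hchain ht
    refine ⟨p, ∑ i, c i + e, hp, (HasDerivAt.sum fun i _ => (hc i).1).add he, le_of_eq ?_⟩
    refine sq_norm_eq_of_tendsto_discrete (P := IsApproxStep D (BoundedSubgrad S h C) C) hC
      (fun _ _ _ hP => hP.1) hJ hJm hJt hbω hτ
      (fun n j hj => ⟨(hα n j hj).1.le, (hα n j hj).2⟩) hstep
      (fun s hs => (hyY s hs).symm ▸ hY s) ht hp ?_
    refine exists_forall_abs_inner_step_le (fun i ε hε => ?_) (fun ε hε => ?_) C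
    · obtain ⟨B, -, hB⟩ := exists_forall_norm_le_of_locBounded (hDb i) (‖y t‖ + 1)
      refine eventually_abs_inner_sub_lt (C := B) (hD i).1 ?_ (hc i).2 hε
      filter_upwards [Metric.ball_mem_nhds (y t) one_pos] with w hw
      refine hB w ?_
      rw [Metric.mem_ball, dist_eq_norm] at hw
      rw [mem_closedBall_zero_iff]
      linarith [norm_le_norm_add_norm_sub' w (y t)]
    · exact eventually_abs_inner_sub_lt (isClosed_graph_boundedSubgrad hS hlip.continuousOn C)
        (Eventually.of_forall fun w v hv => hv.2.1) (hsub C) hε)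
  refine ⟨ω, y 0, y 1, τ, hyS 0, hyS 1, ?_, ?_, hτ0, hτT, ?_⟩
  · rw [hyY 0 (by simp)]
    simpa only [hJ0] using hY 0
  · rw [hyY 1 (by simp)]
    simpa only [hJ1] using hY 1
  · simpa using henergy

/-- Steps that are locally controlled by the fields `D i` and by subgradients of `h` keep the
iterates bounded in finite time. -/
lemma exists_forall_norm_le_of_steps {d N : ℕ} {f : Fin N → Euc d → ℝ}
    (hf : ∀ i, LocallyLipschitz (f i)) {D : Fin N → Euc d → Set (Euc d)}
    (hD : ∀ i, IsConservativeFieldR (D i) (f i)) (hDb : ∀ i, LocBounded (D i))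
    (hne : ∀ i x, (D i x).Nonempty) {S : Set (Euc d)} (hS : IsClosed S) {h : Euc d → ℝ}
    (hlip : LocallyLipschitzOn S h) {c₀ : ℝ} (hc₀ : ∀ x ∈ S, c₀ ≤ ∑ i, f i x + h x)
    {Q : ℝ → Euc d → Euc d → Prop}
    (hQ : ∀ R, ∃ C ≥ 0, ∃ a₀ > 0, ∀ α x x', 0 < α → α ≤ a₀ → x ∈ S → ‖x‖ ≤ R → Q α x x' →
      IsApproxStep D (BoundedSubgrad S h C) C α x x')
    {X₀ : Set (Euc d)} (hX₀ : Bornology.IsBounded X₀) (hX₀S : X₀ ⊆ S) (T : ℝ) :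
    ∃ αbar > (0:ℝ), ∃ r > (0:ℝ), ∀ (α : ℕ → ℝ) (x : ℕ → Euc d),
      (∀ k, Q (α k) (x k) (x (k + 1))) → x 0 ∈ X₀ → (∀ k, 0 < α k ∧ α k ≤ αbar) →
      ∀ k : ℕ, (∑ i ∈ Finset.range k, α i) ≤ T → ∀ j ≤ k, ‖x j‖ ≤ r := by
  classical
  obtain ⟨R₀, hR₀, hX₀R⟩ := hX₀.exists_pos_norm_le
  have hclS : closure X₀ ⊆ S := closure_minimal hX₀S hS
  have hΦcont : ContinuousOn (fun x => ∑ i, f i x + h x) (closure X₀) :=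
    (Continuous.continuousOn (continuous_finsetSum _ fun i _ => (hf i).continuous)).add
      (hlip.continuousOn.mono hclS)
  obtain ⟨M, hM⟩ := hX₀.isCompact_closure.bddAbove_image hΦcont
  set r := R₀ + √(T * (M - c₀)) + 1 with hr
  have hr0 : 0 < r := by positivity
  obtain ⟨C, hC, a₀, ha₀, hstep⟩ := hQ r
  set b : ℕ → ℝ := fun n => min a₀ (1 / (C + 1)) * (1 / ((n : ℝ) + 1)) with hbdef
  have hmin : 0 < min a₀ (1 / (C + 1)) := lt_min ha₀ (by positivity)
  have hbpos : ∀ n, 0 < b n := fun n => by positivity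
  have hb1 : ∀ n, b n ≤ min a₀ (1 / (C + 1)) := fun n => by
    refine mul_le_of_le_one_right hmin.le ?_
    rw [div_le_one (by positivity)]
    linarith [(Nat.cast_nonneg n : (0:ℝ) ≤ n)]
  have hb : Tendsto b atTop (𝓝 0) := by
    simpa only [mul_zero] using
      (tendsto_one_div_add_atTop_nhds_zero_nat (𝕜 := ℝ)).const_mul (min a₀ (1 / (C + 1)))
  by_contra hcon
  push Not at hcon
  have hcon' := fun n => hcon (b n) (hbpos n) r hr0
  choose α x hxQ hx0 hα k hk j hjk hj using hcon'
  have hex : ∀ n, ∃ i, r < ‖x n i‖ := fun n => ⟨j n, hj n⟩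
  set m : ℕ → ℕ := fun n => Nat.find (hex n) with hmdef
  have hm : ∀ n, r < ‖x n (m n)‖ := fun n => Nat.find_spec (hex n)
  have hmin' : ∀ n, ∀ i < m n, ‖x n i‖ ≤ r := fun n i hi => not_lt.1 (Nat.find_min (hex n) hi)
  have hmk : ∀ n, m n ≤ k n := fun n => (Nat.find_min' (hex n) (hj n)).trans (hjk n)
  have hxS : ∀ n, ∀ i ≤ m n, x n i ∈ S := by
    intro n i hi
    induction i with
    | zero => exact hX₀S (hx0 n)
    | succ i ih =>
      obtain ⟨-, -, -, s, -, hs, -⟩ := hstep _ _ _ (hα n i).1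
        ((hα n i).2.trans ((hb1 n).trans (min_le_left _ _))) (ih (by omega))
        (hmin' n i hi) (hxQ n i)
      exact hs.1
  have hsteps : ∀ n, ∀ i < m n,
      IsApproxStep D (BoundedSubgrad S h C) C (α n i) (x n i) (x n (i + 1)) := fun n i hi =>
    hstep _ _ _ (hα n i).1 ((hα n i).2.trans ((hb1 n).trans (min_le_left _ _)))
      (hxS n i hi.le) (hmin' n i hi) (hxQ n i)
  have hxR : ∀ n, ∀ i ≤ m n, ‖x n i‖ ≤ r + 1 := by
    intro n i hi
    cases i with
    | zero =>
      have := hX₀R _ (hx0 n)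
      have := Real.sqrt_nonneg (T * (M - c₀))
      linarith
    | succ i =>
      have h1 := hmin' n i hi
      have h2 := (hsteps n i hi).1
      have h3 : C * α n i ≤ C * (1 / (C + 1)) :=
        mul_le_mul_of_nonneg_left ((hα n i).2.trans ((hb1 n).trans (min_le_right _ _))) hC
      have h4 : C * (1 / (C + 1)) ≤ 1 := by
        rw [mul_one_div, div_le_one (by positivity)]; linarith
      linarith [norm_le_norm_add_norm_sub' (x n (i + 1)) (x n i)]
  obtain ⟨ω, y₀, y₁, τ, -, hy₁S, hy₀, hy₁, hτ0, hτT, hE⟩ :=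
    exists_tendsto_endpoints hf hD hDb hne hS hlip hC (fun n => (hbpos n).le) hb
      (fun n i _ => hα n i) (fun n => (Finset.sum_le_sum_of_subset_of_nonneg
        (Finset.range_mono (hmk n)) fun i _ _ => (hα n i).1.le).trans (hk n)) hsteps hxS hxR
  have h1 : y₀ ∈ closure X₀ := mem_closure_of_tendsto hy₀ (Eventually.of_forall hx0)
  have h2 : ‖y₀‖ ≤ R₀ := le_of_tendsto hy₀.norm (Eventually.of_forall fun n => hX₀R _ (hx0 n))
  have h3 : r ≤ ‖y₁‖ := ge_of_tendsto hy₁.norm (Eventually.of_forall fun n => (hm n).le)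
  have h4 : ∑ i, f i y₀ + h y₀ ≤ M := hM (mem_image_of_mem _ h1)
  have h5 := hc₀ y₁ hy₁S
  have h6 : c₀ ≤ M := (hc₀ y₀ (hclS h1)).trans h4
  have h7 : ‖y₁ - y₀‖ ^ 2 ≤ T * (M - c₀) :=
    hE.trans ((mul_le_mul_of_nonneg_left (by linarith) hτ0).trans
      (mul_le_mul_of_nonneg_right hτT (sub_nonneg.2 h6)))
  have h8 := Real.le_sqrt_of_sq_le h7
  linarith [norm_le_norm_add_norm_sub' y₁ y₀]

end Compactness

section ExtendedReal

open Filter Topology Set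

variable {d : ℕ} {g : Euc d → EReal}

lemma coe_toReal_of_mem_dom (hbot : ∀ x, g x ≠ ⊥) (x : Euc d) (hx : g x ≠ ⊤) :
    ((g x).toReal : EReal) = g x :=
  EReal.coe_toReal hx (hbot x)

lemma ConvexFn.convexOn_toReal (hg : ConvexFn g) (hbot : ∀ x, g x ≠ ⊥) :
    ConvexOn ℝ {x | g x ≠ ⊤} fun x => (g x).toReal := by
  have key : ∀ x, g x ≠ ⊤ → ∀ y, g y ≠ ⊤ → ∀ a b : ℝ, 0 ≤ a → 0 ≤ b → a + b = 1 →
      g (a • x + b • y) ≤ ((a * (g x).toReal + b * (g y).toReal : ℝ) : EReal) := by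
    intro x hx y hy a b ha hb hab
    have h := hg (x := (x, (g x).toReal)) (y := (y, (g y).toReal))
      (coe_toReal_of_mem_dom hbot x hx).ge (coe_toReal_of_mem_dom hbot y hy).ge ha hb hab
    simpa using! h
  have hmem : ∀ x, g x ≠ ⊤ → ∀ y, g y ≠ ⊤ → ∀ a b : ℝ, 0 ≤ a → 0 ≤ b → a + b = 1 →
      g (a • x + b • y) ≠ ⊤ := fun x hx y hy a b ha hb hab =>
    ((key x hx y hy a b ha hb hab).trans_lt (EReal.coe_lt_top _)).ne
  refine ⟨fun x hx y hy a b ha hb hab => hmem x hx y hy a b ha hb hab,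
    fun x hx y hy a b ha hb hab => ?_⟩
  have h := key x hx y hy a b ha hb hab
  rw [← coe_toReal_of_mem_dom hbot _ (hmem x hx y hy a b ha hb hab)] at h
  exact EReal.coe_le_coe_iff.1 h

lemma LocLipOnDom.locallyLipschitzOn (hg : LocLipOnDom g) :
    LocallyLipschitzOn {x | g x ≠ ⊤} fun x => (g x).toReal := by
  intro x hx
  obtain ⟨ε, hε, K, hK⟩ := hg x hx
  refine ⟨K.toNNReal, Metric.closedBall x ε ∩ {x | g x ≠ ⊤},
    inter_mem (mem_nhdsWithin_of_mem_nhds (Metric.closedBall_mem_nhds x hε)) self_mem_nhdsWithin,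
    LipschitzOnWith.of_dist_le_mul fun y hy z hz => ?_⟩
  rw [Real.dist_eq, dist_eq_norm]
  have hy' := hy.1
  have hz' := hz.1
  rw [Metric.mem_closedBall, dist_eq_norm] at hy' hz'
  exact (hK y hy.2 z hz.2 hy' hz').trans
    (mul_le_mul_of_nonneg_right (Real.le_coe_toNNReal K) (norm_nonneg _))

end ExtendedReal

/-- under the standing assumptions, iterates of proximal random
reshuffling initialized in a bounded subset of `dom Φ` remain in a fixed ball as
long as the accumulated step sizes do not exceed `T`, provided the step sizes are
small enough. -/
theorem stmt7 {d N : ℕ} (hN : 1 ≤ N) (f : Fin N → Euc d → ℝ)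
    (D : Fin N → Euc d → Set (Euc d)) (g : Euc d → EReal)
    (hSA : StandingAssumptions N f D g)
    (X₀ : Set (Euc d)) (hX₀b : Bornology.IsBounded X₀)
    (hX₀dom : ∀ x ∈ X₀, Phi N f g x ≠ ⊤)
    (T : ℝ) (hT : 0 < T) :
    ∃ αbar > (0:ℝ), ∃ r > (0:ℝ), ∀ (α : ℕ → ℝ) (x : ℕ → Euc d),
      IsPRR N D g α x → x 0 ∈ X₀ → (∀ k, 0 < α k ∧ α k ≤ αbar) →
      ∀ k : ℕ, 1 ≤ k → (∑ i ∈ Finset.range k, α i) ≤ T →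
        ∀ j ≤ k, x j ∈ Metric.closedBall (0 : Euc d) r := by
  obtain ⟨hf, hD, hDb, hDne, ⟨hgdom, hgbot⟩, hgconv, hgS, hglip, c₀, hc₀⟩ := hSA
  have hcoe := coe_toReal_of_mem_dom hgbot
  obtain ⟨αbar, hαbar, r, hr, key⟩ := exists_forall_norm_le_of_steps hf hD hDb
    (fun i x => (hDne i x).1) hgS hglip.locallyLipschitzOn
    (c₀ := c₀)
    (fun x hx => by
      have := hc₀ x
      rw [Phi, ← hcoe x hx] at this
      exact_mod_cast this)
    (Q := fun α x x' => ∃ (σ : Equiv.Perm (Fin N)) (z : ℕ → Euc d), z 0 = x ∧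
      (∀ i : Fin N, ∃ v ∈ D (σ i) (z i.1), z (i.1 + 1) = z i.1 - α • v) ∧
      g x' ≠ ⊤ ∧ ∀ w, g w ≠ ⊤ →
        (g x').toReal + ‖x' - z N‖ ^ 2 / (2 * α) ≤ (g w).toReal + ‖w - z N‖ ^ 2 / (2 * α))
    (fun R => by
      obtain ⟨C, hC, a₀, ha₀, h⟩ :=
        exists_isApproxStep hDb hgS (hgconv.convexOn_toReal hgbot) hglip.locallyLipschitzOn R
      refine ⟨C, hC, a₀, ha₀, ?_⟩
      rintro α x x' hα hαa hx hxR ⟨σ, z, hz0, hz, hx', hmin⟩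
      exact h α x x' σ z hα hαa hx hxR hz0 hz hx' hmin)
    hX₀b (fun x hx hgx => hX₀dom x hx (by rw [Phi, hgx, EReal.coe_add_top])) T
  refine ⟨αbar, hαbar, r, hr, fun α x hx hx0 hα k _ hkT j hjk => ?_⟩
  rw [mem_closedBall_zero_iff]
  refine key α x (fun n => ?_) hx0 hα k hkT j hjk
  obtain ⟨σ, z, hz0, hz, hmin⟩ := hx n
  obtain ⟨w₀, hw₀⟩ := hgdom
  have hx' : g (x (n + 1)) ≠ ⊤ := by
    intro htop
    have h1 := hmin w₀
    rw [htop, EReal.top_add_coe, ← hcoe w₀ hw₀, ← EReal.coe_add] at h1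
    exact EReal.coe_ne_top _ (top_le_iff.1 h1)
  refine ⟨σ, z, hz0, hz, hx', fun w hw => ?_⟩
  have h1 := hmin w
  rw [← hcoe _ hx', ← hcoe w hw] at h1
  exact_mod_cast h1
end
end

section
/- (Tracking lemma) Let the standing assumptions hold. For every compact set X₀ ⊆ dom Φ and all ε, T > 0 there exists ᾱ > 0 such that for every proximal-random-reshuffling sequence (x_k) initialized at some x₀ ∈ X₀ with step sizes α_k ∈ (0, ᾱ] for all k, there exists an absolutely continuous function x : [0,T] → ℝ^d with derivative u such that x(0) ∈ X₀, x(t) ∈ dom Φ for all t, u(t) ∈ −D_Φ(x(t)) for almost every t ∈ [0,T], and for every k ≥ 1 with α₀ + ⋯ + α_{k−1} ≤ T one has ‖x_k − x(α₀ + ⋯ + α_{k−1})‖ ≤ ε. -/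
open scoped RealInnerProductSpace
open MeasureTheory

noncomputable section

section Tracking

open Filter Topology

/-! ### Convex analysis of the nonsmooth term -/

/-- `p` minimizes `w ↦ g w + ‖w - z‖² / (2a)`. -/
def IsProxPt {d : ℕ} (g : Euc d → EReal) (a : ℝ) (z p : Euc d) : Prop :=
  ∀ w : Euc d, g p + ((‖p - z‖ ^ 2 / (2 * a) : ℝ) : EReal) ≤
    g w + ((‖w - z‖ ^ 2 / (2 * a) : ℝ) : EReal)

lemma ProperFn.coe_toReal {d : ℕ} {g : Euc d → EReal} (hp : ProperFn g) {x : Euc d}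
    (hx : g x ≠ ⊤) : (((g x).toReal : ℝ) : EReal) = g x :=
  EReal.coe_toReal hx (hp.2 x)

lemma ConvexFn.convexOn {d : ℕ} {g : Euc d → EReal} (hp : ProperFn g) (hc : ConvexFn g) :
    ConvexOn ℝ {x | g x ≠ ⊤} (fun x => (g x).toReal) := by
  have key : ∀ x, g x ≠ ⊤ → ∀ y, g y ≠ ⊤ → ∀ a b : ℝ, 0 ≤ a → 0 ≤ b → a + b = 1 →
      g (a • x + b • y) ≤ ((a * (g x).toReal + b * (g y).toReal : ℝ) : EReal) := by
    intro x hx y hy a b ha hb hab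
    have h1 : ((x, (g x).toReal) : Euc d × ℝ) ∈ {p : Euc d × ℝ | g p.1 ≤ (p.2 : EReal)} :=
      (hp.coe_toReal hx).ge
    have h2 : ((y, (g y).toReal) : Euc d × ℝ) ∈ {p : Euc d × ℝ | g p.1 ≤ (p.2 : EReal)} :=
      (hp.coe_toReal hy).ge
    have := hc h1 h2 ha hb hab
    simpa using this
  refine ⟨?_, ?_⟩
  · intro x hx y hy a b ha hb hab
    have := key x hx y hy a b ha hb hab
    exact (this.trans_lt (EReal.coe_lt_top _)).ne
  · intro x hx y hy a b ha hb hab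
    have h := key x hx y hy a b ha hb hab
    rw [← hp.coe_toReal (h.trans_lt (EReal.coe_lt_top _)).ne] at h
    simpa using EReal.coe_le_coe_iff.1 h

lemma mem_subdiff_iff {d : ℕ} {g : Euc d → EReal} (hp : ProperFn g) {x : Euc d} (hx : g x ≠ ⊤)
    (v : Euc d) :
    v ∈ Subdiff g x ↔ ∀ y, g y ≠ ⊤ → (g x).toReal + ⟪v, y - x⟫ ≤ (g y).toReal := by
  constructor
  · intro h y hy
    have := h y
    rw [← hp.coe_toReal hx, ← hp.coe_toReal hy, ← EReal.coe_add] at this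
    exact EReal.coe_le_coe_iff.1 this
  · intro h y
    by_cases hy : g y = ⊤
    · rw [hy]; exact le_top
    · rw [← hp.coe_toReal hx, ← hp.coe_toReal hy, ← EReal.coe_add]
      exact EReal.coe_le_coe_iff.2 (h y hy)

lemma isProxPt_iff {d : ℕ} {g : Euc d → EReal} (hp : ProperFn g) {a : ℝ} {z p : Euc d} :
    IsProxPt g a z p ↔ g p ≠ ⊤ ∧ ∀ w, g w ≠ ⊤ →
      (g p).toReal + ‖p - z‖ ^ 2 / (2 * a) ≤ (g w).toReal + ‖w - z‖ ^ 2 / (2 * a) := by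
  constructor
  · intro h
    have hpt : g p ≠ ⊤ := by
      obtain ⟨w, hw⟩ := hp.1
      have := h w
      intro hpt
      rw [hpt, EReal.top_add_coe, ← hp.coe_toReal hw, ← EReal.coe_add] at this
      exact absurd this (not_le.2 (EReal.coe_lt_top _))
    refine ⟨hpt, fun w hw => ?_⟩
    have := h w
    rw [← hp.coe_toReal hpt, ← hp.coe_toReal hw, ← EReal.coe_add, ← EReal.coe_add] at this
    exact EReal.coe_le_coe_iff.1 this
  · rintro ⟨hpt, h⟩ w
    by_cases hw : g w = ⊤
    · rw [hw, EReal.top_add_coe]; exact le_top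
    · rw [← hp.coe_toReal hpt, ← hp.coe_toReal hw, ← EReal.coe_add, ← EReal.coe_add]
      exact EReal.coe_le_coe_iff.2 (h w hw)

/-- A function that is Lipschitz near `x` and convex decreases at most linearly away from `x`. -/
lemma ConvexOn.sub_mul_norm_le {d : ℕ} {S : Set (Euc d)} {G : Euc d → ℝ} (hG : ConvexOn ℝ S G)
    {x : Euc d} (hx : x ∈ S) {r K : ℝ} (hr : 0 < r)
    (hK : ∀ y ∈ S, ‖y - x‖ ≤ r → |G y - G x| ≤ K * ‖y - x‖) {y : Euc d} (hy : y ∈ S) :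
    G x - K * ‖y - x‖ ≤ G y := by
  by_cases h : ‖y - x‖ ≤ r
  · have := abs_le.1 (hK y hy h)
    linarith [this.1]
  · push Not at h
    have hpos : 0 < ‖y - x‖ := hr.trans h
    set θ := r / ‖y - x‖ with hθ
    have hθ0 : 0 < θ := div_pos hr hpos
    have hθ1 : θ ≤ 1 := (div_le_one hpos).2 h.le
    have hw := hG.1 hx hy (by linarith : 0 ≤ 1 - θ) hθ0.le (by ring)
    have hGw := hG.2 hx hy (by linarith : 0 ≤ 1 - θ) hθ0.le (by ring)
    have hwx : (1 - θ) • x + θ • y - x = θ • (y - x) := by module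
    have hn : ‖(1 - θ) • x + θ • y - x‖ = θ * ‖y - x‖ := by
      rw [hwx, norm_smul, Real.norm_of_nonneg hθ0.le]
    have hle := hK _ hw (by rw [hn, hθ, div_mul_cancel₀ _ hpos.ne'])
    rw [hn] at hle
    have h1 := (abs_le.1 hle).1
    simp only [smul_eq_mul] at hGw
    have : θ * (G x - K * ‖y - x‖) ≤ θ * G y := by nlinarith
    exact le_of_mul_le_mul_left this hθ0

lemma exists_linear_minorant {d : ℕ} {g : Euc d → EReal} (hp : ProperFn g) (hc : ConvexFn g)
    (hcl : IsClosed {x : Euc d | g x ≠ ⊤}) (hL : LocLipOnDom g) (R : ℝ) :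
    ∃ K : ℝ, 0 ≤ K ∧ ∀ x, g x ≠ ⊤ → ‖x‖ ≤ R → ∀ y, g y ≠ ⊤ →
      (g x).toReal - K * ‖y - x‖ ≤ (g y).toReal := by
  have hG := hc.convexOn hp
  have hcomp : IsCompact ({x : Euc d | g x ≠ ⊤} ∩ Metric.closedBall 0 R) :=
    (isCompact_closedBall 0 R).inter_left hcl
  have := hcomp.induction_on (p := fun s => ∃ K : ℝ, 0 ≤ K ∧ ∀ x ∈ s, g x ≠ ⊤ → ∀ y, g y ≠ ⊤ →
      (g x).toReal - K * ‖y - x‖ ≤ (g y).toReal) ⟨0, le_rfl, by simp⟩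
    (fun s t hst ⟨K, hK0, hK⟩ => ⟨K, hK0, fun x hx => hK x (hst hx)⟩) ?_ ?_
  · obtain ⟨K, hK0, hK⟩ := this
    exact ⟨K, hK0, fun x hx hxR => hK x ⟨hx, by simpa using hxR⟩ hx⟩
  · rintro s t ⟨K, hK0, hK⟩ ⟨K', hK0', hK'⟩
    refine ⟨max K K', le_max_of_le_left hK0, ?_⟩
    rintro x (hx | hx) hxS y hy
    · have := hK x hx hxS y hy
      nlinarith [norm_nonneg (y - x), le_max_left K K']
    · have := hK' x hx hxS y hy
      nlinarith [norm_nonneg (y - x), le_max_right K K']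
  · rintro x₀ ⟨hx₀, -⟩
    obtain ⟨r, hr, K, hK⟩ := hL x₀ hx₀
    refine ⟨_, mem_nhdsWithin_of_mem_nhds (Metric.ball_mem_nhds x₀ (half_pos hr)), max K 0,
      le_max_right _ _, ?_⟩
    intro x hx hxS y hy
    rw [Metric.mem_ball, dist_eq_norm] at hx
    refine hG.sub_mul_norm_le (S := {x | g x ≠ ⊤}) hxS (half_pos hr) ?_ hy
    intro w hw hwr
    have h1 : ‖w - x₀‖ ≤ r := by
      have := norm_add_le (w - x) (x - x₀)
      rw [sub_add_sub_cancel] at this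
      linarith
    refine (hK w hw x hxS h1 (by linarith)).trans ?_
    exact mul_le_mul_of_nonneg_right (le_max_left _ _) (norm_nonneg _)

lemma continuousOn_toReal_dom {d : ℕ} {g : Euc d → EReal} (hL : LocLipOnDom g) :
    ContinuousOn (fun x => (g x).toReal) {x : Euc d | g x ≠ ⊤} := by
  intro x hx
  obtain ⟨r, hr, K, hK⟩ := hL x hx
  rw [ContinuousWithinAt, tendsto_iff_dist_tendsto_zero]
  have h0 : Tendsto (fun y => K * ‖y - x‖) (𝓝[{x : Euc d | g x ≠ ⊤}] x) (𝓝 0) := by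
    have : Continuous fun y : Euc d => K * ‖y - x‖ := by fun_prop
    simpa using (this.tendsto x).mono_left nhdsWithin_le_nhds
  refine squeeze_zero' (Eventually.of_forall fun _ => dist_nonneg) ?_ h0
  filter_upwards [self_mem_nhdsWithin,
    mem_nhdsWithin_of_mem_nhds (Metric.closedBall_mem_nhds x hr)] with y hy hyr
  rw [Real.dist_eq]
  exact hK y hy x hx (by simpa [dist_eq_norm] using hyr) (by simpa using hr.le)

lemma exists_isProxPt {d : ℕ} {g : Euc d → EReal} (hp : ProperFn g) (hc : ConvexFn g)
    (hcl : IsClosed {x : Euc d | g x ≠ ⊤}) (hL : LocLipOnDom g) {a : ℝ} (ha : 0 < a)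
    (z : Euc d) : ∃ p, IsProxPt g a z p := by
  obtain ⟨x₀, hx₀⟩ := hp.1
  obtain ⟨K, hK0, hK⟩ := exists_linear_minorant hp hc hcl hL ‖x₀‖
  set F : Euc d → ℝ := fun w => (g w).toReal + ‖w - z‖ ^ 2 / (2 * a) with hF
  have hFc : ContinuousOn F {x : Euc d | g x ≠ ⊤} :=
    (continuousOn_toReal_dom hL).add (by fun_prop)
  set ρ := 2 * a * K + ‖x₀ - z‖ with hρ
  obtain ⟨p, ⟨hpS, -⟩, hmin⟩ := ((isCompact_closedBall z ρ).inter_left hcl).exists_isMinOn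
    (f := F) ⟨x₀, hx₀, by
      rw [Metric.mem_closedBall, dist_eq_norm, hρ]
      have : 0 ≤ 2 * a * K := by positivity
      linarith⟩ (hFc.mono Set.inter_subset_left)
  have hpx₀ : F p ≤ F x₀ := hmin ⟨hx₀, by
      rw [Metric.mem_closedBall, dist_eq_norm, hρ]
      have : 0 ≤ 2 * a * K := by positivity
      linarith⟩
  refine ⟨p, (isProxPt_iff hp).2 ⟨hpS, fun w hw => ?_⟩⟩
  by_cases hwρ : ‖w - z‖ ≤ ρ
  · exact hmin ⟨hw, by simpa [dist_eq_norm] using hwρ⟩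
  · push Not at hwρ
    refine hpx₀.trans ?_
    have h1 := hK x₀ hx₀ le_rfl w hw
    have h2 : ‖w - x₀‖ ≤ ‖w - z‖ + ‖x₀ - z‖ := by
      have := norm_sub_le (w - z) (x₀ - z)
      rwa [sub_sub_sub_cancel_right] at this
    have h4 : K * ‖w - x₀‖ ≤ K * (‖w - z‖ + ‖x₀ - z‖) := mul_le_mul_of_nonneg_left h2 hK0
    have h3 : ‖x₀ - z‖ ^ 2 / (2 * a) + K * (‖w - z‖ + ‖x₀ - z‖) ≤ ‖w - z‖ ^ 2 / (2 * a) := by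
      rw [← sub_nonneg]
      have : ‖w - z‖ ^ 2 / (2 * a) - (‖x₀ - z‖ ^ 2 / (2 * a) + K * (‖w - z‖ + ‖x₀ - z‖))
        = (‖w - z‖ + ‖x₀ - z‖) * (‖w - z‖ - ρ) / (2 * a) := by
        rw [hρ]; field_simp; ring
      rw [this]
      have : 0 ≤ ‖w - z‖ - ρ := by linarith
      positivity
    simp only [hF]
    linarith

lemma IsProxPt.norm_sub_le {d : ℕ} {g : Euc d → EReal} (hp : ProperFn g) {a K B : ℝ} {x z p : Euc d}
    (ha : 0 < a) (hK : 0 ≤ K) (hB : 0 ≤ B) (hx : g x ≠ ⊤)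
    (hmin : ∀ y, g y ≠ ⊤ → (g x).toReal - K * ‖y - x‖ ≤ (g y).toReal)
    (hz : ‖z - x‖ ≤ a * B) (h : IsProxPt g a z p) : ‖p - x‖ ≤ 2 * (K + B) * a := by
  obtain ⟨hpS, hw⟩ := (isProxPt_iff hp).1 h
  have h1 := hw x hx
  have h2 := hmin p hpS
  have h3 : ‖p - z‖ ^ 2 / (2 * a) ≤ ‖x - z‖ ^ 2 / (2 * a) + K * ‖p - x‖ := by linarith
  have h4 : ‖p - z‖ ^ 2 ≤ ‖x - z‖ ^ 2 + 2 * a * (K * ‖p - x‖) := by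
    have := mul_le_mul_of_nonneg_left h3 (by positivity : 0 ≤ 2 * a)
    have e : 2 * a * (‖x - z‖ ^ 2 / (2 * a) + K * ‖p - x‖) =
      ‖x - z‖ ^ 2 + 2 * a * (K * ‖p - x‖) := by field_simp
    rwa [e, mul_div_cancel₀ _ (by positivity)] at this
  have h5 : ‖p - z‖ ^ 2 = ‖p - x‖ ^ 2 - 2 * ⟪p - x, z - x⟫ + ‖z - x‖ ^ 2 := by
    rw [← norm_sub_sq_real, sub_sub_sub_cancel_right]
  have h6 := real_inner_le_norm (p - x) (z - x)
  rw [norm_sub_rev x z] at h4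
  by_contra hcon
  push Not at hcon
  have hpos : 0 < ‖p - x‖ := lt_of_le_of_lt (by positivity) hcon
  nlinarith [mul_le_mul_of_nonneg_left hz hpos.le]

lemma IsProxPt.smul_mem_subdiff {d : ℕ} {g : Euc d → EReal} (hp : ProperFn g) (hc : ConvexFn g)
    {a : ℝ} {z p : Euc d} (ha : 0 < a) (h : IsProxPt g a z p) : a⁻¹ • (z - p) ∈ Subdiff g p := by
  obtain ⟨hpS, hw⟩ := (isProxPt_iff hp).1 h
  have hG := hc.convexOn hp
  rw [mem_subdiff_iff hp hpS]
  intro y hy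
  have key : ∀ θ : ℝ, 0 < θ → θ ≤ 1 →
      (g p).toReal + ⟪a⁻¹ • (z - p), y - p⟫ ≤ (g y).toReal + θ * (‖y - p‖ ^ 2 / (2 * a)) := by
    intro θ h0 h1
    have hq := hG.1 hpS hy (by linarith : 0 ≤ 1 - θ) h0.le (by ring)
    have hGq := hG.2 hpS hy (by linarith : 0 ≤ 1 - θ) h0.le (by ring)
    have hq' := hw _ hq
    have e : (1 - θ) • p + θ • y - z = θ • (y - p) - (z - p) := by module
    have e2 : ‖p - z‖ ^ 2 = ‖z - p‖ ^ 2 := by rw [norm_sub_rev]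
    rw [e, norm_sub_sq_real (θ • (y - p)), norm_smul, Real.norm_of_nonneg h0.le,
      real_inner_smul_left, e2, real_inner_comm] at hq'
    rw [real_inner_smul_left]
    simp only [smul_eq_mul] at hGq
    have h7 : θ * ((g p).toReal + a⁻¹ * ⟪z - p, y - p⟫) ≤
        θ * ((g y).toReal + θ * (‖y - p‖ ^ 2 / (2 * a))) := by
      have e3 : ((θ * ‖y - p‖) ^ 2 - 2 * (θ * ⟪z - p, y - p⟫) + ‖z - p‖ ^ 2) / (2 * a) =
        θ * (θ * (‖y - p‖ ^ 2 / (2 * a))) - θ * (a⁻¹ * ⟪z - p, y - p⟫)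
          + ‖z - p‖ ^ 2 / (2 * a) := by field_simp
      rw [e3] at hq'
      linarith
    exact le_of_mul_le_mul_left h7 h0
  have hlim : Tendsto (fun θ : ℝ => (g y).toReal + θ * (‖y - p‖ ^ 2 / (2 * a))) (𝓝[>] 0)
      (𝓝 (g y).toReal) := by
    have : Continuous fun θ : ℝ => (g y).toReal + θ * (‖y - p‖ ^ 2 / (2 * a)) := by fun_prop
    simpa using (this.tendsto 0).mono_left nhdsWithin_le_nhds
  refine ge_of_tendsto hlim ?_
  filter_upwards [Ioc_mem_nhdsGT one_pos] with θ hθ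
  exact key θ hθ.1 hθ.2

/-! ### Calculus of Lipschitz curves -/

lemma LipschitzWith.intervalIntegrable_deriv_curve {d : ℕ} {Y : ℝ → Euc d} {L : NNReal}
    (hY : LipschitzWith L Y) (a b : ℝ) : IntervalIntegrable (deriv Y) volume a b := by
  refine (intervalIntegrable_const (c := (L : ℝ))).mono_fun
    (stronglyMeasurable_deriv Y).aestronglyMeasurable (Eventually.of_forall fun t => ?_)
  simpa using norm_deriv_le_of_lipschitz hY

lemma LipschitzWith.eq_add_integral_deriv_s8 {d : ℕ} {Y : ℝ → Euc d} {L : NNReal}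
    (hY : LipschitzWith L Y) (a b : ℝ) : Y b = Y a + ∫ s in a..b, deriv Y s := by
  refine ext_inner_left ℝ fun w => ?_
  have hw : LipschitzWith (‖innerSL ℝ w‖₊ * L) (fun s => innerSL ℝ w (Y s)) :=
    (innerSL ℝ w).lipschitz.comp hY
  have h1 := (hw.lipschitzOnWith (s := Set.uIcc a b)).absolutelyContinuousOnInterval
    |>.integral_deriv_eq_sub
  have h2 : ∫ s in a..b, deriv (fun s => innerSL ℝ w (Y s)) s
      = ∫ s in a..b, innerSL ℝ w (deriv Y s) := by
    refine intervalIntegral.integral_congr_ae ?_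
    filter_upwards [hY.ae_differentiableAt_real] with s hs _
    exact ((innerSL ℝ w).hasFDerivAt.comp_hasDerivAt s hs.hasDerivAt).deriv
  rw [h2, (innerSL ℝ w).intervalIntegral_comp_comm (hY.intervalIntegrable_deriv_curve a b)] at h1
  simp only [innerSL_apply_apply] at h1
  rw [inner_add_right]
  linarith

lemma LipschitzOnWith.le_of_ae_deriv_nonpos {φ : ℝ → ℝ} {L : NNReal}
    (hφ : LipschitzOnWith L φ (Set.Icc 0 1))
    (h : ∀ᵐ s ∂volume, s ∈ Set.Ioo (0 : ℝ) 1 → deriv φ s ≤ 0) : φ 1 ≤ φ 0 := by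
  have hφ' : LipschitzOnWith L φ (Set.uIcc 0 1) := by rwa [Set.uIcc_of_le zero_le_one]
  have h1 := hφ'.absolutelyContinuousOnInterval.integral_deriv_eq_sub
  have h2 : 0 ≤ ∫ s in (0 : ℝ)..1, -deriv φ s := by
    refine intervalIntegral.integral_nonneg_of_ae_restrict zero_le_one ?_
    rw [Filter.EventuallyLE, ← restrict_Ioo_eq_restrict_Icc, ae_restrict_iff' measurableSet_Ioo]
    filter_upwards [h] with s hs hs'
    simpa using hs hs'
  rw [intervalIntegral.integral_neg] at h2
  linarith

lemma LocallyLipschitz.exists_lipschitzOnWith_comp {d : ℕ} {f : Euc d → ℝ}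
    (hf : LocallyLipschitz f) {Y : ℝ → Euc d} {L : NNReal} (hY : LipschitzWith L Y) :
    ∃ K, LipschitzOnWith K (fun s => f (Y s)) (Set.Icc 0 1) :=
  ((hf.comp hY.locallyLipschitz).locallyLipschitzOn).exists_lipschitzOnWith_of_compact
    isCompact_Icc

lemma hasDerivAt_toReal_comp {d : ℕ} {g : Euc d → EReal} (hp : ProperFn g) {Y : ℝ → Euc d}
    {t : ℝ} {p v : Euc d} (hdom : ∀ᶠ s in 𝓝 t, g (Y s) ≠ ⊤) (hY : HasDerivAt Y p t)
    (hd : DifferentiableAt ℝ (fun s => (g (Y s)).toReal) t) (hv : v ∈ Subdiff g (Y t)) :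
    HasDerivAt (fun s => (g (Y s)).toReal) ⟪v, p⟫ t := by
  have h1 : HasDerivAt (fun s => (g (Y s)).toReal - ⟪v, Y s⟫)
      (deriv (fun s => (g (Y s)).toReal) t - ⟪v, p⟫) t :=
    hd.hasDerivAt.sub ((innerSL ℝ v).hasFDerivAt.comp_hasDerivAt t hY)
  have hmin : IsLocalMin (fun s => (g (Y s)).toReal - ⟪v, Y s⟫) t := by
    filter_upwards [hdom] with s hs
    have := (mem_subdiff_iff hp hdom.self_of_nhds v).1 hv (Y s) hs
    rw [inner_sub_right] at this
    linarith
  have h2 := hmin.hasDerivAt_eq_zero h1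
  rw [← sub_eq_zero.1 h2]
  exact hd.hasDerivAt

lemma exists_lipschitzOnWith_toReal_comp {d : ℕ} {g : Euc d → EReal} (hp : ProperFn g)
    (hc : ConvexFn g) (hcl : IsClosed {x : Euc d | g x ≠ ⊤}) (hL : LocLipOnDom g)
    {Y : ℝ → Euc d} {L : NNReal} (hY : LipschitzWith L Y)
    (hdom : ∀ t ∈ Set.Icc (0 : ℝ) 1, g (Y t) ≠ ⊤) :
    ∃ K, LipschitzOnWith K (fun s => (g (Y s)).toReal) (Set.Icc 0 1) := by
  obtain ⟨R, hR⟩ := isCompact_Icc.exists_bound_of_continuousOn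
    (hY.continuous.continuousOn (s := Set.Icc (0 : ℝ) 1))
  obtain ⟨K, hK0, hK⟩ := exists_linear_minorant hp hc hcl hL R
  lift K to NNReal using hK0
  refine ⟨K * L, LipschitzOnWith.of_dist_le_mul fun s hs t ht => ?_⟩
  have h1 := hK (Y s) (hdom s hs) (hR s hs) (Y t) (hdom t ht)
  have h2 := hK (Y t) (hdom t ht) (hR t ht) (Y s) (hdom s hs)
  have h3 := hY.dist_le_mul s t
  rw [dist_eq_norm] at h3
  rw [norm_sub_rev] at h1
  have h4 := mul_le_mul_of_nonneg_left h3 K.coe_nonneg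
  rw [NNReal.coe_mul, mul_assoc, Real.dist_eq, abs_le]
  constructor <;> linarith

/-- Energy estimate: a subgradient trajectory run at speed `τ` over `[0, 1]` satisfies a length
bound in terms of the decrease of the objective. -/
lemma norm_sub_le_of_trajectory {d N : ℕ} {f : Fin N → Euc d → ℝ}
    {D : Fin N → Euc d → Set (Euc d)} {g : Euc d → EReal} (hSA : StandingAssumptions N f D g)
    {Y : ℝ → Euc d} {L : NNReal} (hY : LipschitzWith L Y) {τ : ℝ} (hτ : 0 < τ)
    (hdom : ∀ t ∈ Set.Icc (0 : ℝ) 1, g (Y t) ≠ ⊤)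
    (hinc : ∀ t ∈ Set.Ioo (0 : ℝ) 1, ∀ p, HasDerivAt Y p t → -(τ⁻¹ • p) ∈ DPhi N D g (Y t)) :
    ‖Y 1 - Y 0‖ ≤ (1 + τ * ((∑ i, f i (Y 0) + (g (Y 0)).toReal) -
      (∑ i, f i (Y 1) + (g (Y 1)).toReal))) / 2 := by
  obtain ⟨hf, hD, -, hne, hp, hc, hcl, hL, -⟩ := hSA
  set e : Euc d := ‖Y 1 - Y 0‖⁻¹ • (Y 1 - Y 0) with he
  have hen : ‖e‖ ≤ 1 := by
    rw [he, norm_smul, norm_inv, norm_norm]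
    exact inv_mul_le_one
  have hee : ⟪e, Y 1⟫ - ⟪e, Y 0⟫ = ‖Y 1 - Y 0‖ := by
    rw [← inner_sub_right, he, real_inner_smul_left, real_inner_self_eq_norm_sq]
    by_cases h0 : ‖Y 1 - Y 0‖ = 0
    · simp [h0]
    · field_simp
  clear_value e
  choose Kf hKf using fun i => (hf i).exists_lipschitzOnWith_comp hY
  obtain ⟨Kg, hKg⟩ := exists_lipschitzOnWith_toReal_comp hp hc hcl hL hY hdom
  set ψ : ℝ → ℝ := fun s => ∑ i, f i (Y s) + (g (Y s)).toReal with hψ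
  have hψL : ∃ K, LipschitzOnWith K ψ (Set.Icc 0 1) := by
    have : ∀ s : Finset (Fin N), ∃ K, LipschitzOnWith K (fun t => ∑ i ∈ s, f i (Y t))
        (Set.Icc 0 1) := by
      intro s
      induction s using Finset.induction_on with
      | empty => exact ⟨0, by simp [LipschitzOnWith]⟩
      | insert i s hi ih =>
        obtain ⟨K, hK⟩ := ih
        refine ⟨Kf i + K, ?_⟩
        simp only [Finset.sum_insert hi]
        exact (hKf i).add hK
    obtain ⟨K, hK⟩ := this Finset.univ
    exact ⟨_, hK.add hKg⟩
  obtain ⟨Kψ, hKψ⟩ := hψL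
  set φ : ℝ → ℝ := fun s => ⟪e, Y s⟫ + (τ / 2) * ψ s - s / 2 with hφ
  have hφL : ∃ K, LipschitzOnWith K φ (Set.Icc 0 1) := by
    have h1 := ((innerSL ℝ e).lipschitz.comp hY).lipschitzOnWith (s := Set.Icc (0 : ℝ) 1)
    have h2 := ((ContinuousLinearMap.mul ℝ ℝ (τ / 2)).lipschitz).comp_lipschitzOnWith hKψ
    have h3 : LipschitzOnWith _ (fun s : ℝ => (1 / 2 : ℝ) * s) (Set.Icc 0 1) :=
      ((ContinuousLinearMap.mul ℝ ℝ (1 / 2)).lipschitz).lipschitzOnWith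
    have h4 : (fun s => (innerSL ℝ e ∘ Y) s + (ContinuousLinearMap.mul ℝ ℝ (τ / 2) ∘ ψ) s
        - 1 / 2 * s) = φ := by
      funext s
      simp only [hφ, Function.comp_apply, innerSL_apply_apply, ContinuousLinearMap.mul_apply']
      ring
    exact ⟨_, h4 ▸ (h1.add h2).sub h3⟩
  obtain ⟨Kφ, hKφ⟩ := hφL
  have hmain : φ 1 ≤ φ 0 := by
    refine hKφ.le_of_ae_deriv_nonpos ?_
    have hcons := fun i => (hD i).2 Y (deriv Y) (hY.intervalIntegrable_deriv_curve 0 1)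
      (fun t _ => hY.eq_add_integral_deriv_s8 0 t) (fun t _ => (hne i (Y t)).1)
    have hg := hKg.ae_differentiableWithinAt_of_mem_real
    filter_upwards [ae_all_iff.2 hcons, hg, hY.ae_differentiableAt_real] with s hcs hgs hYs hs
    have hnhds : Set.Icc (0 : ℝ) 1 ∈ 𝓝 s := Icc_mem_nhds hs.1 hs.2
    have hgs' := (hgs (Set.Ioo_subset_Icc_self hs)).differentiableAt hnhds
    obtain ⟨v, hv, w, hw, hvw⟩ := hinc s hs _ hYs.hasDerivAt
    have h1 := hasDerivAt_toReal_comp hp (by filter_upwards [hnhds] with r hr using hdom r hr)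
      hYs.hasDerivAt hgs' hw
    have h2 : HasDerivAt ψ (∑ i, ⟪v i, deriv Y s⟫ + ⟪w, deriv Y s⟫) s :=
      (HasDerivAt.fun_sum fun i _ => hcs i hs (v i) (hv i)).add h1
    rw [← sum_inner, ← inner_add_left, ← hvw] at h2
    have h3 : HasDerivAt φ (⟪e, deriv Y s⟫ + (τ / 2) * ⟪-(τ⁻¹ • deriv Y s), deriv Y s⟫ - 1 / 2) s :=
      (((innerSL ℝ e).hasFDerivAt.comp_hasDerivAt s hYs.hasDerivAt).add (h2.const_mul _)).sub
        ((hasDerivAt_id s).div_const 2)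
    rw [h3.deriv, inner_neg_left, real_inner_smul_left, real_inner_self_eq_norm_sq]
    have h4 := (real_inner_le_norm e (deriv Y s)).trans
      (mul_le_of_le_one_left (norm_nonneg _) hen)
    have h5 : τ / 2 * -(τ⁻¹ * ‖deriv Y s‖ ^ 2) = -(‖deriv Y s‖ ^ 2 / 2) := by field_simp
    rw [h5]
    nlinarith [sq_nonneg (‖deriv Y s‖ - 1)]
  simp only [hφ] at hmain
  change ‖Y 1 - Y 0‖ ≤ (1 + τ * (ψ 0 - ψ 1)) / 2
  linarith

/-! ### One step of the method -/

/-- One outer iteration of proximal random reshuffling with step size `a`. -/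
def PRRStep {d : ℕ} (N : ℕ) (D : Fin N → Euc d → Set (Euc d)) (g : Euc d → EReal)
    (a : ℝ) (x x' : Euc d) : Prop :=
  ∃ (σ : Equiv.Perm (Fin N)) (z : ℕ → Euc d), z 0 = x ∧
    (∀ i : Fin N, ∃ v ∈ D (σ i) (z i.1), z (i.1 + 1) = z i.1 - a • v) ∧ IsProxPt g a (z N) x'

/-- A step along bounded elements of the fields `D i` evaluated within `δ` of `x`, plus a bounded
subgradient of `g` evaluated at the new point. -/
def EulerStep {d : ℕ} (N : ℕ) (D : Fin N → Euc d → Set (Euc d)) (g : Euc d → EReal)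
    (M C δ a : ℝ) (x x' : Euc d) : Prop :=
  g x' ≠ ⊤ ∧ ∃ (v y : Fin N → Euc d) (s : Euc d),
    (∀ i, v i ∈ D i (y i) ∧ ‖y i - x‖ ≤ δ ∧ ‖v i‖ ≤ M) ∧
    s ∈ Subdiff g x' ∧ ‖s‖ ≤ C ∧ x' = x - a • (∑ i, v i + s)

lemma LocBounded.exists_bound {d : ℕ} {F : Euc d → Set (Euc d)} (hF : LocBounded F) (R : ℝ) :
    ∃ M : ℝ, 0 ≤ M ∧ ∀ z, ‖z‖ ≤ R → ∀ v ∈ F z, ‖v‖ ≤ M := by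
  have := (isCompact_closedBall (0 : Euc d) R).induction_on
    (p := fun s => ∃ M : ℝ, 0 ≤ M ∧ ∀ z ∈ s, ∀ v ∈ F z, ‖v‖ ≤ M) ⟨0, le_rfl, by simp⟩
    (fun s t hst ⟨M, hM0, hM⟩ => ⟨M, hM0, fun z hz => hM z (hst hz)⟩) ?_ ?_
  · obtain ⟨M, hM0, hM⟩ := this
    exact ⟨M, hM0, fun z hz => hM z (by simpa using hz)⟩
  · rintro s t ⟨M, hM0, hM⟩ ⟨M', hM0', hM'⟩
    refine ⟨max M M', le_max_of_le_left hM0, ?_⟩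
    rintro z (hz | hz) v hv
    · exact (hM z hz v hv).trans (le_max_left _ _)
    · exact (hM' z hz v hv).trans (le_max_right _ _)
  · intro z _
    obtain ⟨r, hr, hb⟩ := hF z
    obtain ⟨M, hM⟩ := hb.exists_norm_le
    refine ⟨_, mem_nhdsWithin_of_mem_nhds (Metric.ball_mem_nhds z hr), max M 0,
      le_max_right _ _, fun y hy v hv => (hM v ?_).trans (le_max_left _ _)⟩
    exact Set.mem_biUnion hy hv

lemma exists_uniform_bound {d N : ℕ} {D : Fin N → Euc d → Set (Euc d)}
    (hD : ∀ i, LocBounded (D i)) (R : ℝ) :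
    ∃ M : ℝ, 0 ≤ M ∧ ∀ i z, ‖z‖ ≤ R → ∀ v ∈ D i z, ‖v‖ ≤ M := by
  choose M hM0 hM using fun i => (hD i).exists_bound R
  refine ⟨∑ i, M i, Finset.sum_nonneg fun i _ => hM0 i, fun i z hz v hv => ?_⟩
  exact (hM i z hz v hv).trans
    (Finset.single_le_sum (f := M) (fun i _ => hM0 i) (Finset.mem_univ i))

lemma PRRStep.eulerStep {d N : ℕ} {D : Fin N → Euc d → Set (Euc d)} {g : Euc d → EReal}
    (hp : ProperFn g) (hc : ConvexFn g) {R M K a : ℝ} {x x' : Euc d} (hM0 : 0 ≤ M) (hK0 : 0 ≤ K)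
    (hM : ∀ i z, ‖z‖ ≤ R + 1 → ∀ v ∈ D i z, ‖v‖ ≤ M)
    (hK : ∀ y, g y ≠ ⊤ → (g x).toReal - K * ‖y - x‖ ≤ (g y).toReal)
    (hxR : ‖x‖ ≤ R) (hx : g x ≠ ⊤) (ha : 0 < a) (haM : a * (N * M) ≤ 1)
    (h : PRRStep N D g a x x') :
    EulerStep N D g M (2 * (K + N * M) + N * M) (a * (N * M)) a x x' ∧
      ‖x' - x‖ ≤ 2 * (K + N * M) * a := by
  obtain ⟨σ, z, hz0, hz, hprox⟩ := h
  choose v hv hzv using hz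
  have hB : 0 ≤ (N : ℝ) * M := by positivity
  have hzR : ∀ i : ℕ, i ≤ N → ‖z i - x‖ ≤ a * (N * M) → ‖z i‖ ≤ R + 1 := by
    intro i _ h1
    have := norm_add_le (z i - x) x
    rw [sub_add_cancel] at this
    linarith
  have hzb : ∀ i : ℕ, i ≤ N → ‖z i - x‖ ≤ a * (i * M) := by
    intro i
    induction i with
    | zero => intro _; simp [hz0]
    | succ i ih =>
      intro hi
      have h1 := ih (by omega)
      have h2 : a * (i * M) ≤ a * (N * M) := by
        have : (i : ℝ) ≤ N := by exact_mod_cast (by omega : i ≤ N)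
        gcongr
      have h3 := hM _ _ (hzR i (by omega) (h1.trans h2)) _ (hv ⟨i, by omega⟩)
      have h4 := hzv ⟨i, by omega⟩
      simp only at h4
      have h5 : z (i + 1) - x = (z i - x) - a • v ⟨i, by omega⟩ := by rw [h4]; abel
      have h6 := norm_sub_le (z i - x) (a • v ⟨i, by omega⟩)
      rw [← h5, norm_smul, Real.norm_of_nonneg ha.le] at h6
      push_cast
      nlinarith [mul_le_mul_of_nonneg_left h3 ha.le]
  have hzN : ∀ i : ℕ, i ≤ N → ‖z i - x‖ ≤ a * (N * M) := fun i hi => (hzb i hi).trans (by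
    have : (i : ℝ) ≤ N := by exact_mod_cast hi
    gcongr)
  have hvM : ∀ i, ‖v i‖ ≤ M := fun i => hM _ _ (hzR i i.2.le (hzN i i.2.le)) _ (hv i)
  have hsum : z N = x - a • ∑ i, v i := by
    have h1 := Finset.sum_range_sub z N
    rw [← Fin.sum_univ_eq_sum_range (fun i => z (i + 1) - z i) N, hz0] at h1
    have h2 : ∑ i : Fin N, (z (i.1 + 1) - z i.1) = -(a • ∑ i, v i) := by
      rw [Finset.smul_sum, ← Finset.sum_neg_distrib]
      exact Finset.sum_congr rfl fun i _ => by rw [hzv i]; abel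
    rw [h2] at h1
    rw [sub_eq_add_neg, h1]; abel
  have hd := hprox.norm_sub_le hp ha hK0 hB hx hK (hzN N le_rfl)
  refine ⟨⟨((isProxPt_iff hp).1 hprox).1, fun i => v (σ.symm i), fun i => z (σ.symm i).1,
    a⁻¹ • (z N - x'), fun i => ⟨?_, hzN _ (σ.symm i).2.le, hvM _⟩,
    hprox.smul_mem_subdiff hp hc ha, ?_, ?_⟩, hd⟩
  · simpa using hv (σ.symm i)
  · rw [norm_smul, Real.norm_of_nonneg (inv_nonneg.2 ha.le), inv_mul_le_iff₀ ha]
    have h1 := norm_sub_le (z N - x) (x' - x)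
    rw [sub_sub_sub_cancel_right] at h1
    have := hzN N le_rfl
    linarith
  · rw [Equiv.sum_comp σ.symm v, smul_add, smul_inv_smul₀ ha.ne', hsum]
    abel

/-! ### Closedness of the truncated field -/

lemma tendsto_subdiff {d : ℕ} {g : Euc d → EReal} (hp : ProperFn g)
    (hcl : IsClosed {x : Euc d | g x ≠ ⊤}) (hL : LocLipOnDom g) {ι : Type*} {l : Filter ι}
    [l.NeBot] {x s : ι → Euc d} {x₀ s₀ : Euc d} (hx : Tendsto x l (𝓝 x₀))
    (hs : Tendsto s l (𝓝 s₀)) (hdom : ∀ᶠ n in l, g (x n) ≠ ⊤)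
    (hsub : ∀ᶠ n in l, s n ∈ Subdiff g (x n)) : s₀ ∈ Subdiff g x₀ := by
  have hx₀ : g x₀ ≠ ⊤ := hcl.mem_of_tendsto hx hdom
  rw [mem_subdiff_iff hp hx₀]
  intro y hy
  have h1 : Tendsto (fun n => (g (x n)).toReal) l (𝓝 (g x₀).toReal) :=
    ((continuousOn_toReal_dom hL) x₀ hx₀).tendsto.comp (tendsto_nhdsWithin_iff.2 ⟨hx, hdom⟩)
  have h2 : Tendsto (fun n => ⟪s n, y - x n⟫) l (𝓝 ⟪s₀, y - x₀⟫) :=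
    hs.inner (tendsto_const_nhds.sub hx)
  refine le_of_tendsto (h1.add h2) ?_
  filter_upwards [hdom, hsub] with n hn hsn
  exact (mem_subdiff_iff hp hn _).1 hsn y hy

lemma exists_tendsto_hyperfilter {d : ℕ} {x : ℕ → Euc d} {R : ℝ} (h : ∀ n, ‖x n‖ ≤ R) :
    ∃ p, Tendsto x (hyperfilter ℕ) (𝓝 p) := by
  obtain ⟨p, -, hp⟩ := isCompact_iff_ultrafilter_le_nhds.1 (isCompact_closedBall (0 : Euc d) R)
    ((hyperfilter ℕ).map x) (by
      rw [Ultrafilter.coe_map, le_principal_iff, mem_map]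
      exact univ_mem' fun n => by simpa using h n)
  exact ⟨p, hp⟩

/-- The elements of `DPhi` at `y` obtained from summands bounded by `M` and `C`. -/
def truncField {d N : ℕ} (D : Fin N → Euc d → Set (Euc d)) (g : Euc d → EReal) (M C : ℝ)
    (y : Euc d) : Set (Euc d) :=
  (fun q : (Fin N → Euc d) × Euc d => ∑ i, q.1 i + q.2) ''
    ((Set.univ.pi fun i => D i y ∩ Metric.closedBall 0 M) ×ˢ
      (Subdiff g y ∩ Metric.closedBall 0 C))

lemma truncField_subset {d N : ℕ} (D : Fin N → Euc d → Set (Euc d)) (g : Euc d → EReal)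
    (M C : ℝ) (y : Euc d) : truncField D g M C y ⊆ DPhi N D g y := by
  rintro _ ⟨⟨v, s⟩, ⟨hv, hs⟩, rfl⟩
  exact ⟨v, fun i => (hv i trivial).1, s, hs.1, rfl⟩

lemma convex_truncField {d N : ℕ} {D : Fin N → Euc d → Set (Euc d)} {g : Euc d → EReal}
    (hp : ProperFn g) (M C : ℝ) {y : Euc d} (hy : g y ≠ ⊤) (hD : ∀ i, Convex ℝ (D i y)) :
    Convex ℝ (truncField D g M C y) := by
  have hsub : Convex ℝ (Subdiff g y) := by
    intro v hv w hw a b ha hb hab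
    rw [mem_subdiff_iff hp hy] at *
    intro z hz
    have h1 := mul_le_mul_of_nonneg_left (hv z hz) ha
    have h2 := mul_le_mul_of_nonneg_left (hw z hz) hb
    rw [inner_add_left, real_inner_smul_left, real_inner_smul_left]
    have e1 : a * (g y).toReal + b * (g y).toReal = (g y).toReal := by rw [← add_mul, hab, one_mul]
    have e2 : a * (g z).toReal + b * (g z).toReal = (g z).toReal := by rw [← add_mul, hab, one_mul]
    linarith
  refine Convex.is_linear_image ((convex_pi fun i _ => (hD i).inter (convex_closedBall _ _)).prod
    (hsub.inter (convex_closedBall _ _))) ?_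
  constructor
  · intro p q
    simp only [Prod.fst_add, Prod.snd_add, Pi.add_apply, Finset.sum_add_distrib]
    abel
  · intro c p
    simp [Finset.smul_sum]

lemma isClosed_truncField {d N : ℕ} {D : Fin N → Euc d → Set (Euc d)} {g : Euc d → EReal}
    (hp : ProperFn g) (M C : ℝ) {y : Euc d} (hy : g y ≠ ⊤)
    (hD : ∀ i, IsClosed {p : Euc d × Euc d | p.2 ∈ D i p.1}) :
    IsClosed (truncField D g M C y) := by
  have hsub : IsClosed (Subdiff g y) := by
    have : Subdiff g y = {v | ∀ z, g z ≠ ⊤ → (g y).toReal + ⟪v, z - y⟫ ≤ (g z).toReal} :=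
      Set.ext fun v => mem_subdiff_iff hp hy v
    rw [this]
    simp only [Set.ofPred_forall]
    exact isClosed_iInter fun z => isClosed_iInter fun _ =>
      isClosed_le (by fun_prop) continuous_const
  refine (IsCompact.image ?_ (by fun_prop)).isClosed
  refine (isCompact_univ_pi fun i => ?_).prod ((isCompact_closedBall _ _).inter_left hsub)
  exact (isCompact_closedBall _ _).inter_left
    ((hD i).preimage (by fun_prop : Continuous fun v : Euc d => (y, v)))

/-- Upper semicontinuity of the truncated field, with base points perturbed independently. -/
lemma exists_radius_truncField {d N : ℕ} {D : Fin N → Euc d → Set (Euc d)} {g : Euc d → EReal}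
    (hp : ProperFn g) (hcl : IsClosed {x : Euc d | g x ≠ ⊤}) (hL : LocLipOnDom g)
    (hD : ∀ i, IsClosed {p : Euc d × Euc d | p.2 ∈ D i p.1}) (M C : ℝ) (y : Euc d) {η : ℝ}
    (hη : 0 < η) :
    ∃ δ > 0, ∀ (v z : Fin N → Euc d) (s q : Euc d),
      (∀ i, v i ∈ D i (z i) ∧ ‖z i - y‖ ≤ δ ∧ ‖v i‖ ≤ M) → g q ≠ ⊤ → s ∈ Subdiff g q →
      ‖q - y‖ ≤ δ → ‖s‖ ≤ C → ∑ i, v i + s ∈ Metric.cthickening η (truncField D g M C y) := by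
  by_contra! hcon
  have hpos : ∀ n : ℕ, (0 : ℝ) < 1 / (n + 1) := fun n => Nat.one_div_pos_of_nat
  choose v z s q hv hq hs hqy hsC hnot using fun n : ℕ => hcon _ (hpos n)
  have hle : ((hyperfilter ℕ : Ultrafilter ℕ) : Filter ℕ) ≤ atTop := Nat.hyperfilter_le_atTop
  have htend : ∀ w : ℕ → Euc d, (∀ n, ‖w n - y‖ ≤ 1 / ((n : ℝ) + 1)) →
      Tendsto w (hyperfilter ℕ) (𝓝 y) := fun w hw =>
    (tendsto_iff_norm_sub_tendsto_zero.2 (squeeze_zero (fun _ => norm_nonneg _) hw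
      tendsto_one_div_add_atTop_nhds_zero_nat)).mono_left hle
  choose v₀ hv₀ using fun i => exists_tendsto_hyperfilter (fun n => (hv n i).2.2)
  obtain ⟨s₀, hs₀⟩ := exists_tendsto_hyperfilter hsC
  have hmem : ∑ i, v₀ i + s₀ ∈ truncField D g M C y := by
    refine ⟨(v₀, s₀), ⟨fun i _ => ⟨?_, ?_⟩, ?_, ?_⟩, rfl⟩
    · exact (hD i).mem_of_tendsto ((htend _ fun n => (hv n i).2.1).prodMk_nhds (hv₀ i))
        (Eventually.of_forall fun n => (hv n i).1)
    · simpa using le_of_tendsto' (hv₀ i).norm fun n => (hv n i).2.2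
    · exact tendsto_subdiff hp hcl hL (htend q hqy) hs₀ (Eventually.of_forall hq)
        (Eventually.of_forall hs)
    · simpa using le_of_tendsto' hs₀.norm hsC
  have hlim : Tendsto (fun n => ∑ i, v n i + s n) (hyperfilter ℕ) (𝓝 (∑ i, v₀ i + s₀)) :=
    (tendsto_finsetSum _ fun i _ => hv₀ i).add hs₀
  obtain ⟨n, hn⟩ := (hlim.eventually (Metric.closedBall_mem_nhds _ hη)).exists
  exact hnot n (Metric.mem_cthickening_of_dist_le _ _ _ _ hmem hn)

/-! ### Limits of discrete trajectories -/

lemma LipschitzWith.tendsto_apply_of_tendsto {d : ℕ} {l : Filter ℕ} {y : ℕ → ℝ → Euc d}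
    {L : NNReal} (hL : ∀ n, LipschitzWith L (y n)) {Y : ℝ → Euc d}
    (hY : ∀ t, Tendsto (fun n => y n t) l (𝓝 (Y t))) {s : ℕ → ℝ} {t : ℝ}
    (hs : Tendsto s l (𝓝 t)) : Tendsto (fun n => y n (s n)) l (𝓝 (Y t)) := by
  have h1 : Tendsto (fun n => y n (s n) - y n t) l (𝓝 0) := by
    rw [tendsto_zero_iff_norm_tendsto_zero]
    have h2 : Tendsto (fun n => (L : ℝ) * ‖s n - t‖) l (𝓝 0) := by
      simpa using (tendsto_iff_norm_sub_tendsto_zero.1 hs).const_mul (L : ℝ)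
    exact squeeze_zero (fun _ => norm_nonneg _) (fun n => (hL n).norm_sub_le _ _) h2
  simpa using h1.add (hY t)

lemma exists_partialSum_le_lt {α : ℕ → ℝ} {K : ℕ} {t : ℝ} (h0 : 0 ≤ t)
    (ht : t < ∑ i ∈ Finset.range K, α i) :
    ∃ k < K, ∑ i ∈ Finset.range k, α i ≤ t ∧ t < ∑ i ∈ Finset.range (k + 1), α i := by
  classical
  have hex : ∃ m, t < ∑ i ∈ Finset.range m, α i := ⟨K, ht⟩
  have h1 := Nat.find_spec hex
  have h2 := Nat.find_min' hex ht
  rcases hm : Nat.find hex with _ | k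
  · rw [hm] at h1; simp at h1; linarith
  · rw [hm] at h1 h2
    exact ⟨k, by omega, not_lt.1 (Nat.find_min hex (by omega : k < Nat.find hex)), h1⟩

/-- A grid point within one step to the left of a given time, when there is one. -/
lemma exists_grid_index {α : ℕ → ℕ → ℝ} {K : ℕ → ℕ} {a : ℕ → ℝ}
    (hα : ∀ n k, k < K n → α n k ≤ a n) {t : ℝ} (h0 : 0 ≤ t) :
    ∃ k : ℕ → ℕ, ∀ n, t < ∑ i ∈ Finset.range (K n), α n i → k n < K n ∧
      ∑ i ∈ Finset.range (k n), α n i ≤ t ∧ t < (∑ i ∈ Finset.range (k n), α n i) + a n := by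
  have : ∀ n, ∃ k, t < ∑ i ∈ Finset.range (K n), α n i → k < K n ∧
      ∑ i ∈ Finset.range k, α n i ≤ t ∧ t < (∑ i ∈ Finset.range k, α n i) + a n := by
    intro n
    by_cases h : t < ∑ i ∈ Finset.range (K n), α n i
    · obtain ⟨k, hk, h1, h2⟩ := exists_partialSum_le_lt h0 h
      rw [Finset.sum_range_succ] at h2
      exact ⟨k, fun _ => ⟨hk, h1, by linarith [hα n k hk]⟩⟩
    · exact ⟨0, fun h' => absurd h' h⟩
  choose k hk using this
  exact ⟨k, hk⟩

lemma tendsto_grid {α : ℕ → ℕ → ℝ} {K k : ℕ → ℕ} {a : ℕ → ℝ} {l : Filter ℕ}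
    (ha : Tendsto a l (𝓝 0)) {t τ : ℝ}
    (hτ : Tendsto (fun n => ∑ i ∈ Finset.range (K n), α n i) l (𝓝 τ)) (ht : t < τ)
    (hk : ∀ n, t < ∑ i ∈ Finset.range (K n), α n i → k n < K n ∧
      ∑ i ∈ Finset.range (k n), α n i ≤ t ∧ t < (∑ i ∈ Finset.range (k n), α n i) + a n) :
    Tendsto (fun n => ∑ i ∈ Finset.range (k n), α n i) l (𝓝 t) := by
  have hev := hτ.eventually (lt_mem_nhds ht)
  refine tendsto_of_tendsto_of_tendsto_of_le_of_le' (g := fun n => t - a n)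
    (by simpa using ha.const_sub t) tendsto_const_nhds ?_ ?_
  · filter_upwards [hev] with n hn
    linarith [(hk n hn).2.2]
  · filter_upwards [hev] with n hn
    exact (hk n hn).2.1

lemma smul_sub_mem_of_steps {d : ℕ} {C : Set (Euc d)} (hC : Convex ℝ C) {α : ℕ → ℝ}
    {x w : ℕ → Euc d} {j k : ℕ} (hjk : j < k) (hα : ∀ i ∈ Finset.Ico j k, 0 < α i)
    (hw : ∀ i ∈ Finset.Ico j k, w i ∈ C)
    (hx : ∀ i ∈ Finset.Ico j k, x (i + 1) = x i - α i • w i) :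
    (∑ i ∈ Finset.range k, α i - ∑ i ∈ Finset.range j, α i)⁻¹ • (x j - x k) ∈ C := by
  rw [← Finset.sum_Ico_eq_sub _ hjk.le]
  have hpos : 0 < ∑ i ∈ Finset.Ico j k, α i :=
    Finset.sum_pos hα ⟨j, Finset.mem_Ico.2 ⟨le_rfl, hjk⟩⟩
  have h1 : x j - x k = ∑ i ∈ Finset.Ico j k, α i • w i := by
    rw [← neg_sub, ← Finset.sum_Ico_sub x hjk.le, ← Finset.sum_neg_distrib]
    exact Finset.sum_congr rfl fun i hi => by rw [hx i hi]; abel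
  rw [h1, Finset.smul_sum]
  simp only [smul_smul]
  refine hC.sum_mem (fun i hi => ?_) ?_ hw
  · exact mul_nonneg (inv_nonneg.2 hpos.le) (hα i hi).le
  · rw [← Finset.mul_sum, inv_mul_cancel₀ hpos.ne']

/-- Limits of discrete trajectories with vanishing step sizes solve the differential inclusion at
every point of differentiability. -/
lemma neg_deriv_mem_DPhi_of_tendsto {d N : ℕ} {f : Fin N → Euc d → ℝ}
    {D : Fin N → Euc d → Set (Euc d)} {g : Euc d → EReal} (hSA : StandingAssumptions N f D g)
    {l : Filter ℕ} [l.NeBot] {M C : ℝ} {α : ℕ → ℕ → ℝ} {x : ℕ → ℕ → Euc d} {K : ℕ → ℕ}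
    {a δ : ℕ → ℝ} (ha : Tendsto a l (𝓝 0)) (hδ : Tendsto δ l (𝓝 0))
    (hα : ∀ n k, k < K n → 0 < α n k ∧ α n k ≤ a n)
    (hstep : ∀ n k, k < K n → EulerStep N D g M C (δ n) (α n k) (x n k) (x n (k + 1)))
    {y : ℕ → ℝ → Euc d} {L : NNReal} (hL : ∀ n, LipschitzWith L (y n))
    (hyx : ∀ n k, k ≤ K n → y n (∑ i ∈ Finset.range k, α n i) = x n k)
    {Y : ℝ → Euc d} (hY : ∀ t, Tendsto (fun n => y n t) l (𝓝 (Y t))) {τ : ℝ}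
    (hτ : Tendsto (fun n => ∑ i ∈ Finset.range (K n), α n i) l (𝓝 τ)) {t : ℝ}
    (ht : t ∈ Set.Ioo 0 τ) (hYt : g (Y t) ≠ ⊤) {p : Euc d} (hp : HasDerivAt Y p t) :
    -p ∈ DPhi N D g (Y t) := by
  obtain ⟨-, hD, -, hne, hpr, hc, hcl, hLip, -⟩ := hSA
  have hDcl := fun i => (hD i).1
  refine truncField_subset D g M C _ ?_
  rw [← (isClosed_truncField hpr M C hYt hDcl).closure_eq, Metric.closure_eq_iInter_cthickening]
  refine Set.mem_iInter₂.2 fun η hη => ?_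
  set Q := Metric.cthickening η (truncField D g M C (Y t)) with hQ
  have hQc : Convex ℝ Q :=
    (convex_truncField hpr M C hYt fun i => (hne i (Y t)).2).cthickening η
  have hQcl : IsClosed Q := Metric.isClosed_cthickening
  obtain ⟨r₀, hr₀, hr⟩ := exists_radius_truncField hpr hcl hLip hDcl M C (Y t) hη
  set ρ : ℝ := r₀ / (4 * (L + 1)) with hρ
  have hL0 : (0 : ℝ) ≤ L := L.coe_nonneg
  have hρ0 : 0 < ρ := by positivity
  have hLρ : L * ρ ≤ r₀ / 4 := by
    rw [hρ, ← mul_div_assoc, div_le_div_iff₀ (by positivity) (by positivity)]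
    nlinarith
  have hquot : ∀ r, t < r → r < t + ρ → r < τ → (r - t)⁻¹ • (Y t - Y r) ∈ Q := by
    intro r htr hrρ hrτ
    have hα' := fun n k hk => (hα n k hk).2
    obtain ⟨j, hj⟩ := exists_grid_index hα' ht.1.le
    obtain ⟨k, hk⟩ := exists_grid_index hα' (ht.1.le.trans htr.le)
    have hjt := tendsto_grid ha hτ ht.2 hj
    have hkr := tendsto_grid ha hτ hrτ hk
    have hev := hτ.eventually (lt_mem_nhds hrτ)
    have hlim : Tendsto (fun n => (∑ i ∈ Finset.range (k n), α n i -
        ∑ i ∈ Finset.range (j n), α n i)⁻¹ • (y n (∑ i ∈ Finset.range (j n), α n i) -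
          y n (∑ i ∈ Finset.range (k n), α n i))) l (𝓝 ((r - t)⁻¹ • (Y t - Y r))) :=
      ((hkr.sub hjt).inv₀ (sub_pos.2 htr).ne').smul
        ((LipschitzWith.tendsto_apply_of_tendsto hL hY hjt).sub
          (LipschitzWith.tendsto_apply_of_tendsto hL hY hkr))
    refine hQcl.mem_of_tendsto hlim ?_
    have hgt : ∀ᶠ n in l, t < ∑ i ∈ Finset.range (k n), α n i :=
      hkr.eventually (lt_mem_nhds htr)
    have haρ : ∀ᶠ n in l, a n < ρ := ha.eventually (gt_mem_nhds hρ0)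
    have hδr : ∀ᶠ n in l, δ n < r₀ / 4 := hδ.eventually (gt_mem_nhds (by positivity))
    have hyY : ∀ᶠ n in l, ‖y n t - Y t‖ < r₀ / 4 :=
      (tendsto_iff_norm_sub_tendsto_zero.1 (hY t)).eventually (gt_mem_nhds (by positivity))
    filter_upwards [hev, hgt, haρ, hδr, hyY] with n hn hgt haρ hδr hyY
    obtain ⟨hjK, hjt, hja⟩ := hj n (htr.trans hn)
    obtain ⟨hkK, hkr, -⟩ := hk n hn
    have hmono : ∀ i m, i ≤ m → m ≤ K n →
        ∑ q ∈ Finset.range i, α n q ≤ ∑ q ∈ Finset.range m, α n q := by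
      intro i m him hm
      refine Finset.sum_le_sum_of_subset_of_nonneg (Finset.range_mono him) fun q hq _ => ?_
      exact (hα n q ((Finset.mem_range.1 hq).trans_le hm)).1.le
    have hjk : j n < k n := by
      by_contra! hcon
      linarith [hmono _ _ hcon hjK.le]
    have hnear : ∀ m, j n ≤ m → m ≤ k n → ‖x n m - Y t‖ ≤ r₀ / 2 := by
      intro m hjm hmk
      have h1 := hmono _ _ hjm (hmk.trans hkK.le)
      have h2 := hmono _ _ hmk hkK.le
      have h3 := (hL n).norm_sub_le (∑ q ∈ Finset.range m, α n q) t
      rw [hyx n m (hmk.trans hkK.le)] at h3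
      have h4 : ‖∑ q ∈ Finset.range m, α n q - t‖ ≤ ρ := by
        rw [Real.norm_eq_abs, abs_le]
        constructor <;> linarith
      have h5 := norm_add_le (x n m - y n t) (y n t - Y t)
      rw [sub_add_sub_cancel] at h5
      have h6 := mul_le_mul_of_nonneg_left h4 hL0
      linarith
    have hsteps : ∀ i, ∃ w, i ∈ Finset.Ico (j n) (k n) →
        w ∈ Q ∧ x n (i + 1) = x n i - α n i • w := by
      intro i
      by_cases hi : i ∈ Finset.Ico (j n) (k n)
      · have hi' := Finset.mem_Ico.1 hi
        obtain ⟨hdom, v, z, s, hv, hs, hsC, hx⟩ := hstep n i (hi'.2.trans hkK)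
        refine ⟨∑ q, v q + s, fun _ => ⟨?_, hx⟩⟩
        refine hr v z s (x n (i + 1)) (fun q => ⟨(hv q).1, ?_, (hv q).2.2⟩) hdom hs ?_ hsC
        · have h1 := hnear i hi'.1 hi'.2.le
          have h2 := norm_add_le (z q - x n i) (x n i - Y t)
          rw [sub_add_sub_cancel] at h2
          linarith [(hv q).2.1]
        · linarith [hnear (i + 1) (by omega) (by omega)]
      · exact ⟨0, fun h => absurd h hi⟩
    choose w hw using hsteps
    rw [hyx n _ hjK.le, hyx n _ hkK.le]
    refine smul_sub_mem_of_steps hQc hjk (fun i hi => ?_) (fun i hi => (hw i hi).1)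
      (fun i hi => (hw i hi).2)
    exact (hα n i ((Finset.mem_Ico.1 hi).2.trans hkK)).1
  have hslope : Tendsto (fun r => (r - t)⁻¹ • (Y t - Y r)) (𝓝[>] t) (𝓝 (-p)) := by
    have h1 := (hasDerivAt_iff_tendsto_slope.1 hp).mono_left
      (nhdsWithin_mono t fun r (hr : t < r) => hr.ne')
    refine h1.neg.congr fun r => ?_
    rw [slope_def_module, ← smul_neg, neg_sub]
  refine hQcl.mem_of_tendsto hslope ?_
  filter_upwards [Ioo_mem_nhdsGT (by linarith : t < t + ρ), Ioo_mem_nhdsGT ht.2] with r h1 h2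
  exact hquot r h1.1 h1.2 h2.2

/-! ### Tracking over a horizon that is exceeded -/

lemma Phi_ne_top_iff {d N : ℕ} {f : Fin N → Euc d → ℝ} {g : Euc d → EReal} {x : Euc d} :
    Phi N f g x ≠ ⊤ ↔ g x ≠ ⊤ := by
  unfold Phi
  constructor
  · intro h hg
    exact h (by rw [hg]; exact EReal.coe_add_top _)
  · intro h
    exact EReal.add_ne_top (EReal.coe_ne_top _) h

lemma EulerStep.mono {d N : ℕ} {D : Fin N → Euc d → Set (Euc d)} {g : Euc d → EReal}
    {M C δ δ' a : ℝ} {x x' : Euc d} (hδ : δ ≤ δ') (h : EulerStep N D g M C δ a x x') :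
    EulerStep N D g M C δ' a x x' := by
  obtain ⟨hdom, v, y, s, hv, hs⟩ := h
  exact ⟨hdom, v, y, s, fun i => ⟨(hv i).1, (hv i).2.1.trans hδ, (hv i).2.2⟩, hs⟩

lemma norm_sub_le_mul_partialSum_sub {d : ℕ} {x : ℕ → Euc d} {α : ℕ → ℝ} {L : ℝ} {i k : ℕ}
    (hik : i ≤ k) (h : ∀ m < k, ‖x (m + 1) - x m‖ ≤ L * α m) :
    ‖x k - x i‖ ≤ L * (∑ m ∈ Finset.range k, α m - ∑ m ∈ Finset.range i, α m) := by
  rw [← Finset.sum_Ico_sub x hik, ← Finset.sum_Ico_eq_sub _ hik, Finset.mul_sum]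
  exact norm_sum_le_of_le _ fun m hm => h m (Finset.mem_Ico.1 hm).2

lemma exists_lipschitz_interpolation {d : ℕ} {S : ℕ → ℝ} {x : ℕ → Euc d} {K : ℕ} {L : NNReal}
    (h : ∀ i k, i ≤ k → k ≤ K → ‖x k - x i‖ ≤ L * |S k - S i|) :
    ∃ y : ℝ → Euc d, LipschitzWith (lipschitzExtensionConstant (Euc d) * L) y ∧
      ∀ k ≤ K, y (S k) = x k := by
  have h' : ∀ i k, i ≤ K → k ≤ K → ‖x k - x i‖ ≤ L * |S k - S i| := by
    intro i k hi hk
    rcases le_total i k with hik | hik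
    · exact h i k hik hk
    · rw [norm_sub_rev, abs_sub_comm]
      exact h k i hik hi
  have hex : ∀ t, ∃ k, t ∈ S '' Set.Iic K → k ≤ K ∧ S k = t := by
    intro t
    by_cases ht : t ∈ S '' Set.Iic K
    · obtain ⟨k, hk⟩ := ht
      exact ⟨k, fun _ => hk⟩
    · exact ⟨0, fun h => absurd h ht⟩
  choose κ hκ using hex
  have hlip : LipschitzOnWith L (fun t => x (κ t)) (S '' Set.Iic K) := by
    refine LipschitzOnWith.of_dist_le_mul fun s hs t ht => ?_
    have := h' _ _ (hκ t ht).1 (hκ s hs).1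
    rwa [(hκ t ht).2, (hκ s hs).2, ← dist_eq_norm, ← Real.dist_eq] at this
  obtain ⟨y, hy, heq⟩ := hlip.extend_finite_dimension
  refine ⟨y, hy, fun k hk => ?_⟩
  have hmem : S k ∈ S '' Set.Iic K := ⟨k, hk, rfl⟩
  rw [← heq hmem]
  have := h' _ _ hk (hκ _ hmem).1
  rw [(hκ _ hmem).2, sub_self, abs_zero, mul_zero] at this
  exact sub_eq_zero.1 (norm_le_zero_iff.1 this)

lemma norm_sub_le_of_trajectory_of_bounds {d N : ℕ} {f : Fin N → Euc d → ℝ}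
    {D : Fin N → Euc d → Set (Euc d)} {g : Euc d → EReal} (hSA : StandingAssumptions N f D g)
    {Y : ℝ → Euc d} {L : NNReal} (hY : LipschitzWith L Y) {τ : ℝ} (hτ : 0 ≤ τ) {E c : ℝ}
    (hE : ∑ i, f i (Y 0) + (g (Y 0)).toReal ≤ E)
    (hc : ∀ x, g x ≠ ⊤ → c ≤ ∑ i, f i x + (g x).toReal)
    (hdom : ∀ t ∈ Set.Icc (0 : ℝ) τ, g (Y t) ≠ ⊤)
    (hinc : ∀ t ∈ Set.Ioo (0 : ℝ) τ, ∀ p, HasDerivAt Y p t → -p ∈ DPhi N D g (Y t)) :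
    ‖Y τ - Y 0‖ ≤ (1 + τ * (E - c)) / 2 := by
  have hEc := hc _ (hdom 0 ⟨le_rfl, hτ⟩)
  have hcτ := hc _ (hdom τ ⟨hτ, le_rfl⟩)
  rcases hτ.eq_or_lt with rfl | hτ0
  · simp
  have hZ : LipschitzWith (L * ‖τ‖₊) (fun s => Y (τ * s)) :=
    hY.comp (((ContinuousLinearMap.mul ℝ ℝ τ).lipschitz).weaken (by simp))
  have h1 := norm_sub_le_of_trajectory hSA hZ hτ0 (fun t ht => hdom _
      ⟨mul_nonneg hτ ht.1, mul_le_of_le_one_right hτ ht.2⟩) (fun t ht p hp => by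
    have hτt : τ * t ∈ Set.Ioo 0 τ := ⟨mul_pos hτ0 ht.1, mul_lt_of_lt_one_right hτ0 ht.2⟩
    refine hinc _ hτt _ ?_
    have h2 : HasDerivAt (fun r : ℝ => τ⁻¹ * r) τ⁻¹ (τ * t) := by
      simpa using (hasDerivAt_id (τ * t)).const_mul τ⁻¹
    have h3 : HasDerivAt (fun s => Y (τ * s)) p (τ⁻¹ * (τ * t)) := by
      rwa [inv_mul_cancel_left₀ hτ0.ne']
    refine (h3.scomp (τ * t) h2).congr_of_eventuallyEq (Eventually.of_forall fun r => ?_)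
    simp only [Function.comp_apply]
    rw [mul_inv_cancel_left₀ hτ0.ne'])
  simp only [mul_one, mul_zero] at h1
  have := mul_le_mul_of_nonneg_left (sub_le_sub hE hcτ) hτ
  linarith

lemma IsPRR.ne_top {d N : ℕ} {D : Fin N → Euc d → Set (Euc d)} {g : Euc d → EReal}
    (hp : ProperFn g) {α : ℕ → ℝ} {x : ℕ → Euc d} (h : IsPRR N D g α x) (h0 : g (x 0) ≠ ⊤)
    (k : ℕ) : g (x k) ≠ ⊤ := by
  cases k with
  | zero => exact h0
  | succ k =>
    obtain ⟨σ, z, -, -, hprox⟩ := h k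
    exact ((isProxPt_iff hp).1 hprox).1

lemma exists_objective_bound {d N : ℕ} {f : Fin N → Euc d → ℝ} {g : Euc d → EReal}
    (hf : ∀ i, LocallyLipschitz (f i)) (hL : LocLipOnDom g) {X₀ : Set (Euc d)}
    (hX₀ : IsCompact X₀) (hdom : ∀ x ∈ X₀, g x ≠ ⊤) :
    ∃ E, ∀ x ∈ X₀, ∑ i, f i x + (g x).toReal ≤ E := by
  have hcont : ContinuousOn (fun x => ∑ i, f i x + (g x).toReal) X₀ :=
    ((continuous_finsetSum _ fun i _ => (hf i).continuous).continuousOn).add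
      ((continuousOn_toReal_dom hL).mono hdom)
  obtain ⟨E, hE⟩ := hX₀.exists_bound_of_continuousOn hcont
  exact ⟨E, fun x hx => (le_abs_self _).trans (hE x hx)⟩

lemma exists_tracking_of_exceeds {d N : ℕ} {f : Fin N → Euc d → ℝ}
    {D : Fin N → Euc d → Set (Euc d)} {g : Euc d → EReal} (hSA : StandingAssumptions N f D g)
    {X₀ : Set (Euc d)} (hX₀ : IsCompact X₀) (hX₀dom : ∀ x ∈ X₀, g x ≠ ⊤) {ε T : ℝ}
    (hε : 0 < ε) (hT : 0 < T) :
    ∃ αbar > (0 : ℝ), ∃ L : NNReal, ∀ (α : ℕ → ℝ) (xs : ℕ → Euc d),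
      IsPRR N D g α xs → xs 0 ∈ X₀ → (∀ k, 0 < α k ∧ α k ≤ αbar) →
      (∃ k, T < ∑ i ∈ Finset.range k, α i) →
      (∀ k, ∑ i ∈ Finset.range k, α i ≤ T → ‖xs (k + 1) - xs k‖ ≤ L * α k) ∧
      ∃ Y : ℝ → Euc d, LipschitzWith L Y ∧ Y 0 ∈ X₀ ∧ (∀ t ∈ Set.Icc 0 T, g (Y t) ≠ ⊤) ∧
        (∀ t ∈ Set.Ioo 0 T, ∀ p, HasDerivAt Y p t → -p ∈ DPhi N D g (Y t)) ∧
        ∀ k, ∑ i ∈ Finset.range k, α i ≤ T →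
          ‖xs k - Y (∑ i ∈ Finset.range k, α i)‖ ≤ ε := by
  have hSA' := hSA
  obtain ⟨hf, -, hDb, -, hp, hc, hcl, hL, c, hΦ⟩ := hSA'
  have hΦ' : ∀ x, g x ≠ ⊤ → c ≤ ∑ i, f i x + (g x).toReal := by
    intro x hx
    have := hΦ x
    rw [Phi, ← hp.coe_toReal hx, ← EReal.coe_add] at this
    exact EReal.coe_le_coe_iff.1 this
  obtain ⟨E, hE⟩ := exists_objective_bound hf hL hX₀ hX₀dom
  obtain ⟨R₀, hR₀⟩ := hX₀.isBounded.exists_norm_le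
  set ρ : ℝ := (1 + (T + 1) * |E - c|) / 2 with hρ
  have hρ0 : 0 ≤ ρ := by positivity
  set R : ℝ := R₀ + ρ + 1 with hR
  obtain ⟨M, hM0, hM⟩ := exists_uniform_bound hDb (R + 1)
  obtain ⟨κ, hκ0, hκ⟩ := exists_linear_minorant hp hc hcl hL R
  have hNM : 0 ≤ (N : ℝ) * M := by positivity
  obtain ⟨L₁, hL₁⟩ : ∃ L₁ : NNReal, (L₁ : ℝ) = 2 * (κ + N * M) :=
    ⟨⟨2 * (κ + N * M), by positivity⟩, rfl⟩
  set L' : NNReal := max L₁ (lipschitzExtensionConstant (Euc d) * L₁) with hL'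
  by_contra hcon
  have hbadn : ∀ n : ℕ, ∃ (α : ℕ → ℝ) (xs : ℕ → Euc d), IsPRR N D g α xs ∧ xs 0 ∈ X₀ ∧
      (∀ k, 0 < α k ∧ α k ≤ min (1 / ((n : ℝ) + 1)) (1 / (N * M + 1))) ∧
      (∃ k, T < ∑ i ∈ Finset.range k, α i) ∧
      ¬ ((∀ k, ∑ i ∈ Finset.range k, α i ≤ T → ‖xs (k + 1) - xs k‖ ≤ L' * α k) ∧
      ∃ Y : ℝ → Euc d, LipschitzWith L' Y ∧ Y 0 ∈ X₀ ∧ (∀ t ∈ Set.Icc 0 T, g (Y t) ≠ ⊤) ∧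
        (∀ t ∈ Set.Ioo 0 T, ∀ p, HasDerivAt Y p t → -p ∈ DPhi N D g (Y t)) ∧
        ∀ k, ∑ i ∈ Finset.range k, α i ≤ T →
          ‖xs k - Y (∑ i ∈ Finset.range k, α i)‖ ≤ ε) := by
    intro n
    by_contra h
    refine hcon ⟨min (1 / ((n : ℝ) + 1)) (1 / (N * M + 1)), by positivity, L',
      fun α xs h1 h2 h3 h4 => ?_⟩
    by_contra h5
    exact h ⟨α, xs, h1, h2, h3, h4, h5⟩
  clear hcon
  choose α xs hPRR hx0 hα hex hbad using hbadn
  have hα0 : ∀ n k, 0 < α n k := fun n k => (hα n k).1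
  have hα1 : ∀ n k, α n k ≤ 1 / ((n : ℝ) + 1) := fun n k => (hα n k).2.trans (min_le_left _ _)
  have hα2 : ∀ n k, α n k * (N * M) ≤ 1 := by
    intro n k
    have h1 := (hα n k).2.trans (min_le_right _ _)
    rw [le_div_iff₀ (by positivity)] at h1
    linarith [hα0 n k]
  set S : ℕ → ℕ → ℝ := fun n k => ∑ i ∈ Finset.range k, α n i with hS
  have hSmono : ∀ n, Monotone (S n) := fun n => monotone_nat_of_le_succ fun k => by
    simp only [hS, Finset.sum_range_succ]
    linarith [hα0 n k]
  have hS0 : ∀ n k, 0 ≤ S n k := fun n k => Finset.sum_nonneg fun i _ => (hα0 n i).le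
  have hdom : ∀ n k, g (xs n k) ≠ ⊤ := fun n k => (hPRR n).ne_top hp (hX₀dom _ (hx0 n)) k
  obtain ⟨K, hK⟩ : ∃ K : ℕ → ℕ, ∀ n, (R < ‖xs n (K n)‖ ∨ T < S n (K n)) ∧
      ∀ k < K n, ‖xs n k‖ ≤ R ∧ S n k ≤ T := by
    classical
    have hex' : ∀ n, ∃ k, R < ‖xs n k‖ ∨ T < S n k := fun n => (hex n).imp fun k => Or.inr
    refine ⟨fun n => Nat.find (hex' n), fun n => ⟨Nat.find_spec (hex' n), fun k hk => ?_⟩⟩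
    have := Nat.find_min (hex' n) hk
    push Not at this
    exact this
  have hKpos : ∀ n, K n ≠ 0 := by
    intro n h0
    have := (hK n).1
    rw [h0] at this
    rcases this with h | h
    · linarith [hR₀ _ (hx0 n)]
    · simp [hS] at h; linarith
  have hSK : ∀ n, S n (K n) ≤ T + 1 := by
    intro n
    obtain ⟨m, hm⟩ := Nat.exists_eq_succ_of_ne_zero (hKpos n)
    have h1 := ((hK n).2 m (by omega)).2
    have h2 : 1 / ((n : ℝ) + 1) ≤ 1 := by
      rw [div_le_one (by positivity)]
      linarith [(Nat.cast_nonneg n : (0 : ℝ) ≤ n)]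
    rw [hm]
    simp only [hS, Nat.succ_eq_add_one, Finset.sum_range_succ] at h1 ⊢
    linarith [hα1 n m]
  have hstep : ∀ n k, k < K n →
      EulerStep N D g M (2 * (κ + N * M) + N * M) (1 / ((n : ℝ) + 1) * (N * M)) (α n k)
        (xs n k) (xs n (k + 1)) ∧ ‖xs n (k + 1) - xs n k‖ ≤ L₁ * α n k := by
    intro n k hk
    have h1 := ((hK n).2 k hk).1
    have h2 := PRRStep.eulerStep hp hc hM0 hκ0 hM (hκ _ (hdom n k) h1) h1 (hdom n k) (hα0 n k)
      (hα2 n k) (hPRR n k)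
    rw [hL₁]
    exact ⟨h2.1.mono (mul_le_mul_of_nonneg_right (hα1 n k) hNM), h2.2⟩
  have hinterp : ∀ n, ∃ y : ℝ → Euc d, LipschitzWith L' y ∧
      ∀ k ≤ K n, y (S n k) = xs n k := by
    intro n
    obtain ⟨y, hy, hyx⟩ := exists_lipschitz_interpolation (S := S n) (x := xs n) (K := K n)
      (L := L₁) (fun i k hik hk => by
        rw [abs_of_nonneg (sub_nonneg.2 (hSmono n hik))]
        exact norm_sub_le_mul_partialSum_sub hik fun m hm => (hstep n m (by omega)).2)
    exact ⟨y, hy.weaken (le_max_right _ _), hyx⟩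
  choose y hyL hyx using hinterp
  have hy0 : ∀ n, y n 0 = xs n 0 := by
    intro n
    simpa [hS] using hyx n 0 (Nat.zero_le _)
  have hYex : ∀ t, ∃ p, Tendsto (fun n => y n t) (hyperfilter ℕ) (𝓝 p) := by
    intro t
    refine exists_tendsto_hyperfilter (R := R₀ + L' * ‖t - 0‖) fun n => ?_
    have h1 := (hyL n).norm_sub_le t 0
    have h2 := norm_add_le (y n t - y n 0) (y n 0)
    rw [sub_add_cancel] at h2
    have h3 := hR₀ _ (hx0 n)
    rw [← hy0] at h3
    linarith
  choose Y hY using hYex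
  have hYL : LipschitzWith L' Y := LipschitzWith.of_dist_le_mul fun s t =>
    le_of_tendsto' ((hY s).dist (hY t)) fun n => (hyL n).dist_le_mul s t
  have hY0 : Y 0 ∈ X₀ := hX₀.isClosed.mem_of_tendsto (hY 0)
    (Eventually.of_forall fun n => by rw [hy0]; exact hx0 n)
  obtain ⟨τ, hτmem, hτ⟩ : ∃ τ ∈ Set.Icc 0 (T + 1),
      Tendsto (fun n => S n (K n)) (hyperfilter ℕ) (𝓝 τ) := by
    obtain ⟨τ, hτ, h⟩ := isCompact_iff_ultrafilter_le_nhds.1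
      (isCompact_Icc (a := (0 : ℝ)) (b := T + 1))
      ((hyperfilter ℕ).map fun n => S n (K n)) (by
        rw [Ultrafilter.coe_map, le_principal_iff, mem_map]
        exact univ_mem' fun n => ⟨hS0 n _, hSK n⟩)
    exact ⟨τ, hτ, h⟩
  have hle : ((hyperfilter ℕ : Ultrafilter ℕ) : Filter ℕ) ≤ atTop := Nat.hyperfilter_le_atTop
  have ha : Tendsto (fun n : ℕ => 1 / ((n : ℝ) + 1)) (hyperfilter ℕ) (𝓝 0) :=
    tendsto_one_div_add_atTop_nhds_zero_nat.mono_left hle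
  have hYτ : Tendsto (fun n => xs n (K n)) (hyperfilter ℕ) (𝓝 (Y τ)) := by
    refine (LipschitzWith.tendsto_apply_of_tendsto hyL hY hτ).congr fun n => ?_
    exact hyx n _ le_rfl
  have hYdom : ∀ t ∈ Set.Icc 0 τ, g (Y t) ≠ ⊤ := by
    rintro t ⟨ht0, htτ⟩
    rcases htτ.eq_or_lt with rfl | htτ
    · exact hcl.mem_of_tendsto hYτ (Eventually.of_forall fun n => hdom n _)
    · obtain ⟨k, hk⟩ := exists_grid_index (fun n k _ => hα1 n k) (K := K) ht0
      refine hcl.mem_of_tendsto (LipschitzWith.tendsto_apply_of_tendsto hyL hY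
        (tendsto_grid ha hτ htτ hk)) ?_
      filter_upwards [hτ.eventually (lt_mem_nhds htτ)] with n hn
      have := hyx n (k n) (hk n hn).1.le
      simp only [hS] at this
      rw [this]
      exact hdom n _
  have hYinc : ∀ t ∈ Set.Ioo 0 τ, ∀ p, HasDerivAt Y p t → -p ∈ DPhi N D g (Y t) := by
    intro t ht p hpt
    exact neg_deriv_mem_DPhi_of_tendsto hSA ha (by simpa using ha.mul_const ((N : ℝ) * M))
      (fun n k _ => ⟨hα0 n k, hα1 n k⟩) (fun n k hk => (hstep n k hk).1) hyL hyx hY hτ ht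
      (hYdom t ⟨ht.1.le, ht.2.le⟩) hpt
  have hYR : ‖Y τ‖ < R := by
    have h1 := norm_sub_le_of_trajectory_of_bounds hSA hYL hτmem.1 (hE _ hY0) hΦ' hYdom hYinc
    have h2 := norm_add_le (Y τ - Y 0) (Y 0)
    rw [sub_add_cancel] at h2
    have h3 : τ * (E - c) ≤ (T + 1) * |E - c| :=
      mul_le_mul hτmem.2 (le_abs_self _) (by
        linarith [hE _ hY0, hΦ' _ (hX₀dom _ hY0)]) (by linarith)
    linarith [hR₀ _ hY0]
  have hKT : ∀ᶠ n in hyperfilter ℕ, T < S n (K n) := by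
    filter_upwards [hYτ.norm.eventually (gt_mem_nhds hYR)] with n hn
    exact (hK n).1.resolve_left hn.le.not_gt
  have hτT : T ≤ τ := ge_of_tendsto hτ (hKT.mono fun n => le_of_lt)
  have hkK : ∀ n, T < S n (K n) → ∀ k, S n k ≤ T → k < K n := by
    intro n hn k hk
    by_contra! h
    linarith [hSmono n h]
  have hfar : ∀ n, ∃ k, T < S n (K n) → S n k ≤ T ∧ ε < ‖xs n k - Y (S n k)‖ := by
    intro n
    by_cases hn : T < S n (K n)
    · by_contra! h
      refine hbad n ⟨fun k hk => ?_, Y, hYL, hY0, fun t ht => hYdom t ⟨ht.1, ht.2.trans hτT⟩,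
        fun t ht => hYinc t ⟨ht.1, ht.2.trans_le hτT⟩, fun k hk => (h k).2 hk⟩
      refine (hstep n k (hkK n hn k hk)).2.trans ?_
      exact mul_le_mul_of_nonneg_right (NNReal.coe_le_coe.2 (le_max_left _ _)) (hα0 n k).le
    · exact ⟨0, fun h => absurd h hn⟩
  choose k hk using hfar
  obtain ⟨s, -, hs⟩ : ∃ s ∈ Set.Icc 0 T,
      Tendsto (fun n => S n (k n)) (hyperfilter ℕ) (𝓝 s) := by
    obtain ⟨s, hs, h⟩ := isCompact_iff_ultrafilter_le_nhds.1 (isCompact_Icc (a := (0 : ℝ)) (b := T))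
      ((hyperfilter ℕ).map fun n => S n (k n)) (by
        rw [Ultrafilter.coe_map, le_principal_iff, mem_map]
        exact hKT.mono fun n hn => ⟨hS0 n _, (hk n hn).1⟩)
    exact ⟨s, hs, h⟩
  have hlim : Tendsto (fun n => ‖y n (S n (k n)) - Y (S n (k n))‖) (hyperfilter ℕ) (𝓝 0) := by
    have h1 := (LipschitzWith.tendsto_apply_of_tendsto hyL hY hs).sub
      ((hYL.continuous.tendsto s).comp hs)
    simpa using h1.norm
  obtain ⟨n, hn, hnT⟩ := ((hlim.eventually (gt_mem_nhds hε)).and hKT).exists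
  obtain ⟨h1, h2⟩ := hk n hnT
  rw [hyx n _ (hkK n hnT _ h1).le] at hn
  exact lt_asymm hn h2

/-! ### Prolongation of reshuffling sequences and the general case -/

lemma StandingAssumptions.exists_prrStep {d N : ℕ} {f : Fin N → Euc d → ℝ}
    {D : Fin N → Euc d → Set (Euc d)} {g : Euc d → EReal} (hSA : StandingAssumptions N f D g)
    {a : ℝ} (ha : 0 < a) (x : Euc d) : ∃ x', PRRStep N D g a x x' := by
  obtain ⟨-, -, -, hne, hp, hc, hcl, hL, -⟩ := hSA
  choose w hw using fun i y => (hne i y).1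
  let z : ℕ → Euc d := fun k => Nat.rec x
    (fun k y => if h : k < N then y - a • w ⟨k, h⟩ y else y) k
  obtain ⟨p, hpz⟩ := exists_isProxPt hp hc hcl hL ha (z N)
  refine ⟨p, Equiv.refl _, z, rfl, fun i => ⟨w i (z i), hw i _, ?_⟩, hpz⟩
  exact dif_pos i.2

/-- A reshuffling sequence can be prolonged from any index on with a constant step size. -/
lemma IsPRR.exists_prolongation {d N : ℕ} {f : Fin N → Euc d → ℝ}
    {D : Fin N → Euc d → Set (Euc d)} {g : Euc d → EReal} (hSA : StandingAssumptions N f D g)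
    {α : ℕ → ℝ} {xs : ℕ → Euc d} (h : IsPRR N D g α xs) {a : ℝ} (ha : 0 < a) (K : ℕ) :
    ∃ xs', IsPRR N D g (fun k => if k < K then α k else a) xs' ∧ ∀ k ≤ K, xs' k = xs k := by
  choose next hnext using hSA.exists_prrStep ha
  refine ⟨fun k => next^[k - K] (xs (min k K)), fun k => ?_, fun k hk => ?_⟩
  · rcases lt_or_ge k K with hk | hk
    · simp only [if_pos hk, Nat.sub_eq_zero_of_le hk.le, Nat.sub_eq_zero_of_le hk,
        min_eq_left hk.le, min_eq_left (Nat.succ_le_of_lt hk), Function.iterate_zero, id]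
      exact h k
    · simp only [if_neg hk.not_gt, Nat.succ_sub hk, min_eq_right hk,
        min_eq_right (Nat.le_succ_of_le hk), Nat.succ_eq_add_one, Function.iterate_succ_apply']
      exact hnext _
  · simp [Nat.sub_eq_zero_of_le hk, min_eq_left hk]

lemma exists_lt_sum_range_ite {α : ℕ → ℝ} {a : ℝ} (ha : 0 < a) (K : ℕ) (T : ℝ) :
    ∃ k, T < ∑ i ∈ Finset.range k, if i < K then α i else a := by
  obtain ⟨n, hn⟩ := exists_nat_gt ((T - ∑ i ∈ Finset.range K, α i) / a)
  rw [div_lt_iff₀ ha] at hn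
  refine ⟨K + n, ?_⟩
  rw [Finset.sum_range_add, Finset.sum_congr rfl fun i hi => if_pos (Finset.mem_range.1 hi)]
  simp only [not_lt.2 (Nat.le_add_right _ _), if_false, Finset.sum_const, Finset.card_range,
    nsmul_eq_mul]
  linarith

lemma sum_range_ite_of_le {α : ℕ → ℝ} {a : ℝ} {k K : ℕ} (hk : k ≤ K) :
    ∑ i ∈ Finset.range k, (if i < K then α i else a) = ∑ i ∈ Finset.range k, α i :=
  Finset.sum_congr rfl fun _ hi => if_pos ((Finset.mem_range.1 hi).trans_le hk)

lemma exists_tracking {d N : ℕ} {f : Fin N → Euc d → ℝ}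
    {D : Fin N → Euc d → Set (Euc d)} {g : Euc d → EReal} (hSA : StandingAssumptions N f D g)
    {X₀ : Set (Euc d)} (hX₀ : IsCompact X₀) (hX₀dom : ∀ x ∈ X₀, g x ≠ ⊤)
    {ε T : ℝ} (hε : 0 < ε) (hT : 0 < T) :
    ∃ αbar > (0 : ℝ), ∃ L : NNReal, ∀ (α : ℕ → ℝ) (xs : ℕ → Euc d),
      IsPRR N D g α xs → xs 0 ∈ X₀ → (∀ k, 0 < α k ∧ α k ≤ αbar) →
      ∃ Y : ℝ → Euc d, LipschitzWith L Y ∧ Y 0 ∈ X₀ ∧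
        (∀ t ∈ Set.Icc (0 : ℝ) T, g (Y t) ≠ ⊤) ∧
        (∀ t ∈ Set.Ioo (0 : ℝ) T, ∀ p, HasDerivAt Y p t → -p ∈ DPhi N D g (Y t)) ∧
        ∀ k, ∑ i ∈ Finset.range k, α i ≤ T → ‖xs k - Y (∑ i ∈ Finset.range k, α i)‖ ≤ ε := by
  obtain ⟨a, ha, L, H⟩ := exists_tracking_of_exceeds hSA hX₀ hX₀dom (half_pos hε) hT
  refine ⟨a, ha, L, fun α xs hxs hx0 hα => ?_⟩
  by_cases hex : ∃ k, T < ∑ i ∈ Finset.range k, α i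
  · obtain ⟨-, Y, hY, hY0, hYdom, hYinc, hYx⟩ := H α xs hxs hx0 hα hex
    exact ⟨Y, hY, hY0, hYdom, hYinc, fun k hk => (hYx k hk).trans (half_le_self hε.le)⟩
  push Not at hex
  have hprol : ∀ K, (∀ k < K, ‖xs (k + 1) - xs k‖ ≤ L * α k) ∧ ∃ Y : ℝ → Euc d,
      LipschitzWith L Y ∧ Y 0 ∈ X₀ ∧ (∀ t ∈ Set.Icc (0 : ℝ) T, g (Y t) ≠ ⊤) ∧
      (∀ t ∈ Set.Ioo (0 : ℝ) T, ∀ p, HasDerivAt Y p t → -p ∈ DPhi N D g (Y t)) ∧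
      ∀ k ≤ K, ‖xs k - Y (∑ i ∈ Finset.range k, α i)‖ ≤ ε / 2 := by
    intro K
    obtain ⟨xs', hxs', heq⟩ := hxs.exists_prolongation hSA ha K
    obtain ⟨hstep, Y, hY, hY0, hYdom, hYinc, hYx⟩ := H _ xs' hxs'
      (by rwa [heq 0 (Nat.zero_le _)])
      (fun k => by
        split_ifs
        · exact hα k
        · exact ⟨ha, le_rfl⟩)
      (exists_lt_sum_range_ite ha K T)
    refine ⟨fun k hk => ?_, Y, hY, hY0, hYdom, hYinc, fun k hk => ?_⟩
    · have := hstep k (by rw [sum_range_ite_of_le hk.le]; exact hex k)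
      rwa [heq _ hk, heq _ hk.le, if_pos hk] at this
    · have := hYx k (by rw [sum_range_ite_of_le hk]; exact hex k)
      rwa [heq k hk, sum_range_ite_of_le hk] at this
  have hstep : ∀ k, ‖xs (k + 1) - xs k‖ ≤ L * α k := fun k => (hprol (k + 1)).1 k k.lt_succ_self
  have hS : CauchySeq fun k => ∑ i ∈ Finset.range k, α i :=
    (summable_of_sum_range_le (fun k => (hα k).1.le) hex).hasSum.tendsto_sum_nat.cauchySeq
  obtain ⟨K, hK⟩ := Metric.cauchySeq_iff'.1 hS (ε / (4 * (L + 1))) (by positivity)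
  obtain ⟨-, Y, hY, hY0, hYdom, hYinc, hYx⟩ := hprol K
  refine ⟨Y, hY, hY0, hYdom, hYinc, fun k _ => ?_⟩
  rcases le_total k K with hk | hk
  · exact (hYx k hk).trans (half_le_self hε.le)
  · have h1 := norm_sub_le_mul_partialSum_sub hk fun m _ => hstep m
    have h2 := hYx K le_rfl
    have h3 := hY.dist_le_mul (∑ i ∈ Finset.range K, α i) (∑ i ∈ Finset.range k, α i)
    rw [dist_eq_norm, dist_comm] at h3
    have h4 : L * dist (∑ i ∈ Finset.range k, α i) (∑ i ∈ Finset.range K, α i) ≤ ε / 4 := by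
      refine (mul_le_mul_of_nonneg_left (hK k hk).le L.coe_nonneg).trans ?_
      rw [mul_div_assoc', div_le_div_iff₀ (by positivity) (by norm_num)]
      linarith
    have h5 := mul_le_mul_of_nonneg_left
      (le_abs_self (∑ i ∈ Finset.range k, α i - ∑ i ∈ Finset.range K, α i)) L.coe_nonneg
    rw [← Real.dist_eq] at h5
    have h6 := norm_add₃_le (a := xs k - xs K) (b := xs K - Y (∑ i ∈ Finset.range K, α i))
      (c := Y (∑ i ∈ Finset.range K, α i) - Y (∑ i ∈ Finset.range k, α i))
    rw [sub_add_sub_cancel, sub_add_sub_cancel] at h6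
    linarith

end Tracking

/-- tracking lemma: under the standing assumptions, for every compact
`X₀ ⊆ dom Φ` and every `ε, T > 0`, if the step sizes are small enough then any
proximal random reshuffling sequence initialized in `X₀` is tracked, up to accuracy
`ε` on the time interval `[0,T]`, by a trajectory of the differential inclusion
`x' ∈ −D_Φ(x)` starting in `X₀`. -/
theorem stmt8 {d N : ℕ} (hN : 1 ≤ N) (f : Fin N → Euc d → ℝ)
    (D : Fin N → Euc d → Set (Euc d)) (g : Euc d → EReal)
    (hSA : StandingAssumptions N f D g)
    (X₀ : Set (Euc d)) (hX₀c : IsCompact X₀)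
    (hX₀dom : ∀ x ∈ X₀, Phi N f g x ≠ ⊤)
    (ε T : ℝ) (hε : 0 < ε) (hT : 0 < T) :
    ∃ αbar > (0:ℝ), ∀ (α : ℕ → ℝ) (xs : ℕ → Euc d),
      IsPRR N D g α xs → xs 0 ∈ X₀ → (∀ k, 0 < α k ∧ α k ≤ αbar) →
      ∃ x u : ℝ → Euc d,
        IntervalIntegrable u volume 0 T ∧
        (∀ t ∈ Set.Icc (0:ℝ) T, x t = x 0 + ∫ s in (0:ℝ)..t, u s) ∧
        x 0 ∈ X₀ ∧
        (∀ t ∈ Set.Icc (0:ℝ) T, Phi N f g (x t) ≠ ⊤) ∧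
        (∀ᵐ t ∂volume, t ∈ Set.Ioo (0:ℝ) T → -u t ∈ DPhi N D g (x t)) ∧
        ∀ k : ℕ, 1 ≤ k → (∑ i ∈ Finset.range k, α i) ≤ T →
          ‖xs k - x (∑ i ∈ Finset.range k, α i)‖ ≤ ε := by
  obtain ⟨a, ha, L, H⟩ :=
    exists_tracking hSA hX₀c (fun x hx => Phi_ne_top_iff.1 (hX₀dom x hx)) hε hT
  refine ⟨a, ha, fun α xs hxs hx0 hα => ?_⟩
  obtain ⟨Y, hY, hY0, hYdom, hYinc, hYx⟩ := H α xs hxs hx0 hα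
  refine ⟨Y, deriv Y, hY.intervalIntegrable_deriv_curve 0 T,
    fun t _ => hY.eq_add_integral_deriv_s8 0 t, hY0, fun t ht => Phi_ne_top_iff.2 (hYdom t ht),
    ?_, fun k _ => hYx k⟩
  filter_upwards [hY.ae_differentiableAt_real] with t ht htT
  exact hYinc t htT _ ht.hasDerivAt
end
end
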